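/- arXiv:math/9201230 — 2 statements merged into one kernel-verified Lean document; each statement's English description precedes it below -/
import Mathlib

section
/- Let (e_i) be a subsymmetric normalized basis of a reflexive Banach space E with biorthogonal functionals (e_i'), and let 1 < p < ∞. Assume that (i) E satisfies an upper p-estimate with respect to (e_i), (ii) (e_i') does not dominate (e_i), and (iii) the unit vector basis of ℓ^p does not dominate (e_i'). Let X = J(e_i) be the James-type space over (e_i). Then both X and X' have Property (w), but neither X' nor X'' is weakly sequentially complete. -/
open Filter Topology

noncomputable section

/-- An operator between normed spaces is *weakly compact* if the image of the closed unit
ball is relatively compact in the weak topology of the codomain. -/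
def IsWeaklyCompactOperator {X Y : Type*} [NormedAddCommGroup X] [NormedSpace ℝ X]
    [NormedAddCommGroup Y] [NormedSpace ℝ Y] (T : X →L[ℝ] Y) : Prop :=
  IsCompact (closure (toWeakSpace ℝ Y '' (T '' Metric.closedBall 0 1)))

/-- An operator between normed spaces is *compact* if the image of the closed unit ball is
relatively norm-compact. -/
def IsCompactOp {X Y : Type*} [NormedAddCommGroup X] [NormedSpace ℝ X]
    [NormedAddCommGroup Y] [NormedSpace ℝ Y] (T : X →L[ℝ] Y) : Prop :=
  IsCompact (closure (T '' Metric.closedBall 0 1))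

/-- A Banach space has *Property (w)* if every operator into its dual is weakly compact. -/
def PropertyW (X : Type*) [NormedAddCommGroup X] [NormedSpace ℝ X] : Prop :=
  ∀ T : X →L[ℝ] (X →L[ℝ] ℝ), IsWeaklyCompactOperator T

/-- A normed space is *weakly sequentially complete* if every weakly Cauchy sequence is
weakly convergent. -/
def WeaklySeqComplete (X : Type*) [NormedAddCommGroup X] [NormedSpace ℝ X] : Prop :=
  ∀ x : ℕ → X,
    (∀ f : X →L[ℝ] ℝ, ∃ L : ℝ, Tendsto (fun n => f (x n)) atTop (𝓝 L)) →
    ∃ x₀ : X, ∀ f : X →L[ℝ] ℝ, Tendsto (fun n => f (x n)) atTop (𝓝 (f x₀))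

/-- A normed space is reflexive if the canonical embedding into the double dual is
surjective. -/
def IsReflexiveSpace (X : Type*) [NormedAddCommGroup X] [NormedSpace ℝ X] : Prop :=
  Function.Surjective (NormedSpace.inclusionInDoubleDual ℝ X)

/-- `(e i)` is a normalized unconditional basic sequence. -/
def IsNormalizedUnconditionalBasic {E : Type*} [NormedAddCommGroup E] [NormedSpace ℝ E]
    (e : ℕ → E) : Prop :=
  (∀ i, ‖e i‖ = 1) ∧
  ∃ C : ℝ, ∀ S F : Finset ℕ, S ⊆ F → ∀ a : ℕ → ℝ,
    ‖∑ i ∈ S, a i • e i‖ ≤ C * ‖∑ i ∈ F, a i • e i‖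

/-- `(x i)` dominates `(y i)`. -/
def Dominates {X Y : Type*} [NormedAddCommGroup X] [NormedSpace ℝ X]
    [NormedAddCommGroup Y] [NormedSpace ℝ Y] (x : ℕ → X) (y : ℕ → Y) : Prop :=
  ∃ C : ℝ, ∀ (s : Finset ℕ) (a : ℕ → ℝ),
    ‖∑ i ∈ s, a i • y i‖ ≤ C * ‖∑ i ∈ s, a i • x i‖

/-- Two sequences are equivalent if each dominates the other. -/
def EquivalentSeq {X Y : Type*} [NormedAddCommGroup X] [NormedSpace ℝ X]
    [NormedAddCommGroup Y] [NormedSpace ℝ Y] (x : ℕ → X) (y : ℕ → Y) : Prop :=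
  Dominates x y ∧ Dominates y x

/-- `(v n)` is a block basis of `(e i)`. -/
def IsBlockBasis {E : Type*} [NormedAddCommGroup E] [NormedSpace ℝ E]
    (e v : ℕ → E) : Prop :=
  ∃ q : ℕ → ℕ, StrictMono q ∧ ∃ a : ℕ → ℝ,
    ∀ n, v n ≠ 0 ∧ v n = ∑ i ∈ Finset.Ico (q n) (q (n + 1)), a i • e i

/-- A sequence is semi-normalized. -/
def SemiNormalized {E : Type*} [NormedAddCommGroup E] (x : ℕ → E) : Prop :=
  ∃ c C : ℝ, 0 < c ∧ ∀ i, c ≤ ‖x i‖ ∧ ‖x i‖ ≤ C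

/-- `(e i)` is right dominant. -/
def RightDominantBound {E : Type*} [NormedAddCommGroup E] [NormedSpace ℝ E]
    (e : ℕ → E) : Prop :=
  ∃ C : ℝ, ∀ m n : ℕ → ℕ, (∀ i, m i ≤ n i) → (∀ i, n i < m (i + 1)) →
    ∀ (s : Finset ℕ) (a : ℕ → ℝ),
      ‖∑ i ∈ s, a i • e (m i)‖ ≤ C * ‖∑ i ∈ s, a i • e (n i)‖

/-- The James norm associated to `(e i)` of a (finitely supported) scalar sequence. -/
def jamesNorm {E : Type*} [NormedAddCommGroup E] [NormedSpace ℝ E]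
    (e : ℕ → E) (a : ℕ → ℝ) : ℝ :=
  sSup { x : ℝ | ∃ (k : ℕ) (p : ℕ → ℕ), 0 < k ∧ p 0 = 0 ∧ StrictMono p ∧
    x = ‖∑ i ∈ Finset.range k, (∑ j ∈ Finset.Ico (p i) (p (i + 1)), a j) • e (p i)‖ }

/-- `X`, together with the sequence `(u i)`, is the James-type space over `(e i)`. -/
def IsJamesSpace {E X : Type*} [NormedAddCommGroup E] [NormedSpace ℝ E]
    [NormedAddCommGroup X] [NormedSpace ℝ X] (e : ℕ → E) (u : ℕ → X) : Prop :=
  Dense (Submodule.span ℝ (Set.range u) : Set X) ∧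
  ∀ a : ℕ →₀ ℝ, ‖∑ i ∈ a.support, a i • u i‖ = jamesNorm e (a : ℕ → ℝ)

/-- `(e i)` is shrinking: the span of the biorthogonal functionals is dense in the dual of
the closed linear span of `(e i)`. -/
def IsShrinking {E : Type*} [NormedAddCommGroup E] [NormedSpace ℝ E] (e : ℕ → E) : Prop :=
  ∃ e' : ℕ → ((Submodule.span ℝ (Set.range e)).topologicalClosure →L[ℝ] ℝ),
    (∀ i j, e' i ⟨e j, Submodule.le_topologicalClosure _
        (Submodule.subset_span (Set.mem_range_self j))⟩ = if i = j then 1 else 0) ∧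
    Dense (Submodule.span ℝ (Set.range e') :
      Set ((Submodule.span ℝ (Set.range e)).topologicalClosure →L[ℝ] ℝ))

/-- `E` satisfies an upper `p`-estimate with respect to the unconditional basis `(e i)`. -/
def UpperPEstimate {E : Type*} [NormedAddCommGroup E] [NormedSpace ℝ E]
    (e : ℕ → E) (p : ℝ) : Prop :=
  ∃ C : ℝ, ∀ (n : ℕ) (x : ℕ → E) (s : ℕ → Finset ℕ) (a : ℕ → ℕ → ℝ),
    (∀ k, k < n → x k = ∑ i ∈ s k, a k i • e i) →
    (∀ k l, k < n → l < n → k ≠ l → Disjoint (s k) (s l)) →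
    ‖∑ k ∈ Finset.range n, x k‖ ≤ C * (∑ k ∈ Finset.range n, ‖x k‖ ^ p) ^ (1 / p)

/-- `(e i)` is subsymmetric: unconditional and equivalent to all of its subsequences. -/
def IsSubsymmetric {E : Type*} [NormedAddCommGroup E] [NormedSpace ℝ E] (e : ℕ → E) : Prop :=
  (∃ C : ℝ, ∀ S F : Finset ℕ, S ⊆ F → ∀ a : ℕ → ℝ,
    ‖∑ i ∈ S, a i • e i‖ ≤ C * ‖∑ i ∈ F, a i • e i‖) ∧
  ∀ φ : ℕ → ℕ, StrictMono φ → EquivalentSeq e (e ∘ φ)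

/-- `(e i)` is a symmetric basic sequence: equivalent to all of its permutations. -/
def IsSymmetricSeq {E : Type*} [NormedAddCommGroup E] [NormedSpace ℝ E] (e : ℕ → E) : Prop :=
  ∀ σ : Equiv.Perm ℕ, EquivalentSeq e (fun i => e (σ i))

/-- A topological space is scattered if every nonempty closed subset has a point isolated
in that subset. -/
def Scattered (K : Type*) [TopologicalSpace K] : Prop :=
  ∀ C : Set K, C.Nonempty → IsClosed C → ∃ x ∈ C, ∃ U : Set K, IsOpen U ∧ U ∩ C = {x}

end


open Filter Topology

theorem jw_gantmacher {Z Y : Type*} [NormedAddCommGroup Z] [NormedSpace ℝ Z]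
    [NormedAddCommGroup Y] [NormedSpace ℝ Y] (T : Z →L[ℝ] Y)
    (h : ∀ φ : (Z →L[ℝ] ℝ) →L[ℝ] ℝ, ∃ y : Y, ∀ ψ : Y →L[ℝ] ℝ, φ (ψ.comp T) = ψ y) :
    IsWeaklyCompactOperator T := by
  choose y hy using h
  let G : WeakDual ℝ (Z →L[ℝ] ℝ) → WeakSpace ℝ Y :=
    fun φ => toWeakSpace ℝ Y (y (WeakDual.toStrongDual φ))
  have hG : Continuous G := by
    refine WeakBilin.continuous_of_continuous_eval _ (fun ψ => ?_)
    have : Continuous fun φ : WeakDual ℝ (Z →L[ℝ] ℝ) => φ ((ψ : Y →L[ℝ] ℝ).comp T) :=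
      WeakDual.eval_continuous _
    convert this using 2 with φ
    exact (hy (WeakDual.toStrongDual φ) ψ).symm
  have hK := (WeakDual.isCompact_closedBall (𝕜 := ℝ) (0 : StrongDual ℝ (Z →L[ℝ] ℝ)) 1).image hG
  have hinj : Function.Injective (topDualPairing ℝ Y).flip := by
    intro a b hab
    refine (SeparatingDual.eq_iff_forall_dual_eq (R := ℝ)).2 fun g => ?_
    exact LinearMap.congr_fun hab g
  have : T2Space (WeakSpace ℝ Y) := (WeakBilin.isEmbedding hinj).t2Space
  refine hK.of_isClosed_subset isClosed_closure (closure_minimal ?_ hK.isClosed)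
  rintro _ ⟨_, ⟨x, hx, rfl⟩, rfl⟩
  refine ⟨StrongDual.toWeakDual (NormedSpace.inclusionInDoubleDual ℝ Z x), ?_, ?_⟩
  · simp only [Set.mem_preimage, mem_closedBall_zero_iff] at hx ⊢
    exact (NormedSpace.double_dual_bound ℝ Z x).trans hx
  · change toWeakSpace ℝ Y _ = toWeakSpace ℝ Y _
    congr 1
    refine (SeparatingDual.eq_iff_forall_dual_eq (R := ℝ)).2 fun g => ?_
    have := hy (NormedSpace.inclusionInDoubleDual ℝ Z x) g
    exact this.symm

theorem jw_abstract {Z Y : Type*} [NormedAddCommGroup Z] [NormedSpace ℝ Z]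
    [NormedAddCommGroup Y] [NormedSpace ℝ Y] (z : ℕ → Z) (ζ : (Z →L[ℝ] ℝ) →L[ℝ] ℝ)
    (h1 : ∀ f : Z →L[ℝ] ℝ, Tendsto (fun n => f (z n)) atTop (𝓝 (ζ f)))
    (h2 : ∀ φ : (Z →L[ℝ] ℝ) →L[ℝ] ℝ, ∃ (x : Z) (c : ℝ), ∀ f, φ f = f x + c * ζ f)
    (b : ℕ → Y) (C : ℝ)
    (h3 : ∀ n : ℕ → ℕ, StrictMono n → ∀ (s : Finset ℕ) (c : ℕ → ℝ),
      ‖∑ k ∈ s, c k • (z (n (2 * k)) - z (n (2 * k + 1)))‖ ≤ C * ‖∑ k ∈ s, c k • b k‖)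
    (hno : ¬ ∃ K : ℝ, ∀ (s : Finset ℕ) (a c : ℕ → ℝ),
      |∑ k ∈ s, a k * c k| ≤ K * (‖∑ k ∈ s, a k • b k‖ * ‖∑ k ∈ s, c k • b k‖)) :
    PropertyW Z := by
  intro T
  set α : ℝ := ζ (ζ.comp T) with hα
  set β : ℝ := ζ (ζ.comp T.flip) with hβ
  by_cases hαβ : α = β
  · apply jw_gantmacher
    intro φ
    obtain ⟨x, c, hx⟩ := h2 φ
    refine ⟨T x + c • ζ.comp T.flip, fun ψ => ?_⟩
    obtain ⟨w, d, hw⟩ := h2 ψ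
    have e1 : ζ (ψ.comp T) = ψ (ζ.comp T.flip) := by
      have : ψ.comp T = T.flip w + d • ζ.comp T := by
        ext v
        simp [hw]
      rw [this, hw]
      simp only [map_add, map_smul, smul_eq_mul]
      rw [← hα, ← hβ, hαβ]
      rfl
    rw [hx, e1]
    simp
  exfalso
  apply hno
  have hγ : 0 < |α - β| := abs_pos.2 (sub_ne_zero.2 hαβ)
  refine ⟨|α - β|⁻¹ * (‖T‖ * (C * C)), fun s a c => ?_⟩
  rw [mul_assoc, ← div_eq_inv_mul, le_div_iff₀ hγ]
  set A : ℝ := ∑ k ∈ s, |a k| with hA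
  set D : ℝ := ∑ k ∈ s, |c k| with hD
  have hA0 : 0 ≤ A := Finset.sum_nonneg fun _ _ => abs_nonneg _
  have hD0 : 0 ≤ D := Finset.sum_nonneg fun _ _ => abs_nonneg _
  refine le_of_forall_pos_le_add fun η hη => ?_
  obtain ⟨ε, hε, hεη⟩ : ∃ ε > 0, 4 * ε * (A * D) ≤ η := by
    refine ⟨η / (4 * (A * D + 1)), by positivity, ?_⟩
    rw [show 4 * (η / (4 * (A * D + 1))) * (A * D) = η * ((A * D) / (A * D + 1)) by field_simp]
    have : (A * D) / (A * D + 1) ≤ 1 := by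
      rw [div_le_one (by positivity)]; linarith
    nlinarith
  -- choose subsequence
  have hA' : Tendsto (fun n => ζ (T (z n))) atTop (𝓝 α) := h1 (ζ.comp T)
  have hB' : Tendsto (fun n => ζ (T.flip (z n))) atTop (𝓝 β) := h1 (ζ.comp T.flip)
  have key := exists_seq_of_forall_finset_exists
    (fun n : ℕ => |ζ (T (z n)) - α| < ε ∧ |ζ (T.flip (z n)) - β| < ε)
    (fun m n : ℕ => m < n ∧ |T (z m) (z n) - α| < ε ∧ |T (z n) (z m) - β| < ε)
    (by
      intro F hF
      have ev1 : ∀ᶠ n in atTop, |ζ (T (z n)) - α| < ε := by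
        have := hA'.eventually (Metric.ball_mem_nhds α hε)
        simpa [Real.dist_eq] using this
      have ev2 : ∀ᶠ n in atTop, |ζ (T.flip (z n)) - β| < ε := by
        have := hB'.eventually (Metric.ball_mem_nhds β hε)
        simpa [Real.dist_eq] using this
      have ev3 : ∀ᶠ n in atTop, ∀ m ∈ F,
          m < n ∧ |T (z m) (z n) - α| < ε ∧ |T (z n) (z m) - β| < ε := by
        rw [Filter.eventually_all_finset]
        intro m hm
        have q1 : ∀ᶠ n in atTop, |T (z m) (z n) - α| < ε := by
          have : ∀ᶠ x : ℝ in 𝓝 (ζ (T (z m))), |x - α| < ε :=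
            (isOpen_lt (by fun_prop) (by fun_prop)).mem_nhds (hF m hm).1
          exact (h1 (T (z m))).eventually this
        have q2 : ∀ᶠ n in atTop, |T (z n) (z m) - β| < ε := by
          have : ∀ᶠ x : ℝ in 𝓝 (ζ (T.flip (z m))), |x - β| < ε :=
            (isOpen_lt (by fun_prop) (by fun_prop)).mem_nhds (hF m hm).2
          exact (h1 (T.flip (z m))).eventually this
        filter_upwards [q1, q2, eventually_gt_atTop m] with n a1 a2 a3
        exact ⟨a3, a1, a2⟩
      obtain ⟨n, a1, a2, a3⟩ := (ev1.and (ev2.and ev3)).exists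
      exact ⟨n, ⟨a1, a2⟩, a3⟩)
  obtain ⟨φ, -, hφ⟩ := key
  have hφm : StrictMono φ := fun m n h => (hφ m n h).1
  set x : ℕ → Z := fun k => z (φ (4 * k)) - z (φ (4 * k + 2)) with hx
  set y : ℕ → Z := fun k => z (φ (4 * k + 1)) - z (φ (4 * k + 3)) with hy
  have hxb : ‖∑ k ∈ s, a k • x k‖ ≤ C * ‖∑ k ∈ s, a k • b k‖ := by
    have := h3 (fun j => φ (2 * j)) (fun i j h => hφm (by omega)) s a
    convert this using 6 <;> congr 1 <;> ring
  have hyb : ‖∑ k ∈ s, c k • y k‖ ≤ C * ‖∑ k ∈ s, c k • b k‖ := by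
    have := h3 (fun j => φ (2 * j + 1)) (fun i j h => hφm (by omega)) s c
    convert this using 6 <;> congr 1 <;> ring
  have hxy : ∀ k l, |T (x k) (y l) - (if k = l then α - β else 0)| ≤ 4 * ε := by
    intro k l
    have exp : T (x k) (y l) = T (z (φ (4 * k))) (z (φ (4 * l + 1)))
        - T (z (φ (4 * k))) (z (φ (4 * l + 3))) - T (z (φ (4 * k + 2))) (z (φ (4 * l + 1)))
        + T (z (φ (4 * k + 2))) (z (φ (4 * l + 3))) := by
      simp only [hx, hy, map_sub, ContinuousLinearMap.sub_apply]
      ring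
    have u1 : ∀ i j, i < j → |T (z (φ i)) (z (φ j)) - α| < ε := fun i j h => (hφ i j h).2.1
    have u2 : ∀ i j, j < i → |T (z (φ i)) (z (φ j)) - β| < ε := fun i j h => (hφ j i h).2.2
    rw [exp]
    rcases lt_trichotomy k l with h | h | h
    · rw [if_neg h.ne]
      have a1 := abs_lt.1 (u1 (4 * k) (4 * l + 1) (by omega))
      have a2 := abs_lt.1 (u1 (4 * k) (4 * l + 3) (by omega))
      have a3 := abs_lt.1 (u1 (4 * k + 2) (4 * l + 1) (by omega))
      have a4 := abs_lt.1 (u1 (4 * k + 2) (4 * l + 3) (by omega))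
      rw [abs_le]; constructor <;> linarith [a1.1, a1.2, a2.1, a2.2, a3.1, a3.2, a4.1, a4.2]
    · rw [if_pos h]
      have a1 := abs_lt.1 (u1 (4 * k) (4 * l + 1) (by omega))
      have a2 := abs_lt.1 (u1 (4 * k) (4 * l + 3) (by omega))
      have a3 := abs_lt.1 (u2 (4 * k + 2) (4 * l + 1) (by omega))
      have a4 := abs_lt.1 (u1 (4 * k + 2) (4 * l + 3) (by omega))
      rw [abs_le]; constructor <;> linarith [a1.1, a1.2, a2.1, a2.2, a3.1, a3.2, a4.1, a4.2]
    · rw [if_neg h.ne']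
      have a1 := abs_lt.1 (u2 (4 * k) (4 * l + 1) (by omega))
      have a2 := abs_lt.1 (u2 (4 * k) (4 * l + 3) (by omega))
      have a3 := abs_lt.1 (u2 (4 * k + 2) (4 * l + 1) (by omega))
      have a4 := abs_lt.1 (u2 (4 * k + 2) (4 * l + 3) (by omega))
      rw [abs_le]; constructor <;> linarith [a1.1, a1.2, a2.1, a2.2, a3.1, a3.2, a4.1, a4.2]
  have expand : T (∑ k ∈ s, a k • x k) (∑ l ∈ s, c l • y l)
      = ∑ k ∈ s, ∑ l ∈ s, a k * c l * T (x k) (y l) := by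
    simp only [map_sum, map_smul, ContinuousLinearMap.sum_apply, ContinuousLinearMap.smul_apply,
      smul_eq_mul, Finset.mul_sum]
    rw [Finset.sum_comm]
    refine Finset.sum_congr rfl fun k _ => Finset.sum_congr rfl fun l _ => by ring
  have diag : (α - β) * ∑ k ∈ s, a k * c k
      = ∑ k ∈ s, ∑ l ∈ s, a k * c l * (if k = l then α - β else 0) := by
    rw [Finset.mul_sum]
    refine Finset.sum_congr rfl fun k hk => ?_
    simp only [mul_ite, mul_zero, Finset.sum_ite_eq, hk, if_true]
    ring
  have err : |T (∑ k ∈ s, a k • x k) (∑ l ∈ s, c l • y l) - (α - β) * ∑ k ∈ s, a k * c k|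
      ≤ 4 * ε * (A * D) := by
    rw [expand, diag, ← Finset.sum_sub_distrib]
    calc _ ≤ ∑ k ∈ s, ∑ l ∈ s, |a k| * |c l| * (4 * ε) := by
          refine (Finset.abs_sum_le_sum_abs _ _).trans (Finset.sum_le_sum fun k _ => ?_)
          rw [← Finset.sum_sub_distrib]
          refine (Finset.abs_sum_le_sum_abs _ _).trans (Finset.sum_le_sum fun l _ => ?_)
          rw [← mul_sub, abs_mul, abs_mul]
          exact mul_le_mul_of_nonneg_left (hxy k l) (by positivity)
      _ = 4 * ε * (A * D) := by
          rw [hA, hD, Finset.sum_mul_sum, Finset.mul_sum]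
          refine Finset.sum_congr rfl fun k _ => ?_
          rw [Finset.mul_sum]
          refine Finset.sum_congr rfl fun l _ => by ring
  have up : |T (∑ k ∈ s, a k • x k) (∑ l ∈ s, c l • y l)|
      ≤ ‖T‖ * (C * C) * (‖∑ k ∈ s, a k • b k‖ * ‖∑ k ∈ s, c k • b k‖) := by
    calc _ ≤ ‖T‖ * ‖∑ k ∈ s, a k • x k‖ * ‖∑ l ∈ s, c l • y l‖ := by
          rw [← Real.norm_eq_abs]; exact T.le_opNorm₂ _ _
      _ ≤ ‖T‖ * (C * ‖∑ k ∈ s, a k • b k‖) * (C * ‖∑ k ∈ s, c k • b k‖) := by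
          gcongr
          have hT : 0 ≤ ‖T‖ := norm_nonneg T
          exact mul_nonneg hT ((norm_nonneg _).trans hxb)
      _ = _ := by ring
  calc |∑ k ∈ s, a k * c k| * |α - β| = |(α - β) * ∑ k ∈ s, a k * c k| := by
        rw [abs_mul, mul_comm]
    _ ≤ |T (∑ k ∈ s, a k • x k) (∑ l ∈ s, c l • y l)|
        + |T (∑ k ∈ s, a k • x k) (∑ l ∈ s, c l • y l) - (α - β) * ∑ k ∈ s, a k * c k| := by
        have := abs_sub_abs_le_abs_sub ((α - β) * ∑ k ∈ s, a k * c k)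
          (T (∑ k ∈ s, a k • x k) (∑ l ∈ s, c l • y l))
        rw [abs_sub_comm] at this
        linarith
    _ ≤ _ := by linarith

/-- weak Cauchy criterion -/
theorem jw_conv (g : ℕ → ℝ) (B : ℝ) (hB : ∀ n, |g n| ≤ B)
    (h : ∀ n : ℕ → ℕ, StrictMono n → ∀ ε > 0, ¬ ∀ k, ε ≤ g (n (2 * k)) - g (n (2 * k + 1))) :
    ∃ L, Tendsto g atTop (𝓝 L) := by
  refine tendsto_of_no_upcrossings dense_univ ?_ ?_ ?_
  · rintro a - b - hab ⟨ha, hb⟩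
    obtain ⟨φ, hφ, hP⟩ := extraction_forall_of_frequently
      (P := fun n k => if n % 2 = 0 then b < g k else g k < a) (by
        intro n
        by_cases hn : n % 2 = 0
        · simpa [hn] using hb
        · simpa [hn] using ha)
    refine h φ hφ (b - a) (sub_pos.2 hab) fun k => ?_
    have h1 := hP (2 * k)
    have h2 := hP (2 * k + 1)
    rw [if_pos (by omega)] at h1
    rw [if_neg (by omega)] at h2
    linarith
  · exact ⟨B, eventually_map.2 (Eventually.of_forall fun n => (abs_le.1 (hB n)).2)⟩
  · exact ⟨-B, eventually_map.2 (Eventually.of_forall fun n => (abs_le.1 (hB n)).1)⟩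

/-- pointwise limits of functionals -/
theorem jw_lim {Z : Type*} [NormedAddCommGroup Z] [NormedSpace ℝ Z] (z : ℕ → Z)
    (h : ∀ f : Z →L[ℝ] ℝ, ∃ L : ℝ, Tendsto (fun n => f (z n)) atTop (𝓝 L)) :
    ∃ ζ : (Z →L[ℝ] ℝ) →L[ℝ] ℝ,
      ∀ f : Z →L[ℝ] ℝ, Tendsto (fun n => f (z n)) atTop (𝓝 (ζ f)) := by
  choose L hL using h
  refine ⟨continuousLinearMapOfTendsto (l := atTop)
    (fun n => NormedSpace.inclusionInDoubleDual ℝ Z (z n)) (f := L)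
    (tendsto_pi_nhds.2 fun f => by simpa using hL f), fun f => hL f⟩

/-- extension of operators from a sequence with dense span -/
theorem jw_ext {Z Y : Type*} [NormedAddCommGroup Z] [NormedSpace ℝ Z]
    [NormedAddCommGroup Y] [NormedSpace ℝ Y] [CompleteSpace Y] (u : ℕ → Z)
    (hd : Dense (Submodule.span ℝ (Set.range u) : Set Z)) (y : ℕ → Y) (C : ℝ) (hC : 0 ≤ C)
    (h : ∀ a : ℕ →₀ ℝ, ‖Finsupp.linearCombination ℝ y a‖ ≤ C * ‖Finsupp.linearCombination ℝ u a‖) :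
    ∃ T : Z →L[ℝ] Y, (∀ i, T (u i) = y i) ∧ ‖T‖ ≤ C := by
  have hr : DenseRange (Finsupp.linearCombination ℝ u) := by
    have : Set.range (Finsupp.linearCombination ℝ u) = (Submodule.span ℝ (Set.range u) : Set Z) := by
      rw [← Finsupp.range_linearCombination]; rfl
    rw [DenseRange, this]; exact hd
  refine ⟨(Finsupp.linearCombination ℝ y).extendOfNorm (Finsupp.linearCombination ℝ u), fun i => ?_,
    LinearMap.opNorm_extendOfNorm_le hr hC h⟩
  have := LinearMap.extendOfNorm_eq (f := Finsupp.linearCombination ℝ y) hr ⟨C, h⟩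
    (Finsupp.single i 1)
  simpa using this

theorem jw_dense {Z : Type*} [NormedAddCommGroup Z] [NormedSpace ℝ Z] (u : ℕ → Z)
    (hd : Dense (Submodule.span ℝ (Set.range u) : Set Z)) (x : Z) (η : ℝ) (hη : 0 < η) :
    ∃ a : ℕ →₀ ℝ, ‖x - Finsupp.linearCombination ℝ u a‖ < η := by
  obtain ⟨z, hz, hxz⟩ := Metric.dense_iff.1 hd x η hη
  have : z ∈ LinearMap.range (Finsupp.linearCombination ℝ u) := by
    rw [Finsupp.range_linearCombination]; exact hxz
  obtain ⟨a, rfl⟩ := this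
  refine ⟨a, ?_⟩
  rw [← dist_eq_norm, dist_comm]; exact hz

open Filter Topology

section basis
variable {E : Type*} [NormedAddCommGroup E] [NormedSpace ℝ E]

theorem jw_coord (e : ℕ → E) (e' : ℕ → E →L[ℝ] ℝ)
    (he' : ∀ i j, e' i (e j) = if i = j then 1 else 0) (s : Finset ℕ) (b : ℕ → ℝ) (i : ℕ) :
    e' i (∑ j ∈ s, b j • e j) = if i ∈ s then b i else 0 := by
  simp [map_sum, he']

theorem jw_coord_lc (e : ℕ → E) (e' : ℕ → E →L[ℝ] ℝ)
    (he' : ∀ i j, e' i (e j) = if i = j then 1 else 0) (a : ℕ →₀ ℝ) (i : ℕ) :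
    e' i (Finsupp.linearCombination ℝ e a) = a i := by
  rw [Finsupp.linearCombination_apply, Finsupp.sum, jw_coord e e' he']
  by_cases h : i ∈ a.support
  · rw [if_pos h]
  · rw [if_neg h]; exact (Finsupp.notMem_support_iff.1 h).symm

theorem jw_proj (e : ℕ → E) (hdense : Dense (Submodule.span ℝ (Set.range e) : Set E))
    (e' : ℕ → E →L[ℝ] ℝ) (he' : ∀ i j, e' i (e j) = if i = j then 1 else 0)
    (K : ℝ) (hK : ∀ S F : Finset ℕ, S ⊆ F → ∀ a : ℕ → ℝ,
      ‖∑ i ∈ S, a i • e i‖ ≤ K * ‖∑ i ∈ F, a i • e i‖) (s : Finset ℕ) (x : E) :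
    ‖∑ i ∈ s, e' i x • e i‖ ≤ K * ‖x‖ := by
  have hcl : IsClosed {x : E | ‖∑ i ∈ s, e' i x • e i‖ ≤ K * ‖x‖} :=
    isClosed_le (by fun_prop) (by fun_prop)
  have : (Submodule.span ℝ (Set.range e) : Set E) ⊆ {x : E | ‖∑ i ∈ s, e' i x • e i‖ ≤ K * ‖x‖} := by
    intro x hx
    have : x ∈ LinearMap.range (Finsupp.linearCombination ℝ e) := by
      rw [Finsupp.range_linearCombination]; exact hx
    obtain ⟨a, rfl⟩ := this
    simp only [Set.mem_ofPred_eq, jw_coord_lc e e' he']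
    have h1 := hK s (s ∪ a.support) Finset.subset_union_left a
    have h2 : ∑ i ∈ s ∪ a.support, a i • e i = Finsupp.linearCombination ℝ e a := by
      rw [Finsupp.linearCombination_apply, Finsupp.sum]
      symm
      refine Finset.sum_subset Finset.subset_union_right fun i _ hi => ?_
      rw [Finsupp.notMem_support_iff.1 hi, zero_smul]
    rwa [h2] at h1
  have h2 := hcl.closure_subset_iff.2 this
  rw [hdense.closure_eq] at h2
  exact h2 (Set.mem_univ x)

theorem jw_coord_norm (e : ℕ → E) (hdense : Dense (Submodule.span ℝ (Set.range e) : Set E))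
    (hnorm : ∀ i, ‖e i‖ = 1)
    (e' : ℕ → E →L[ℝ] ℝ) (he' : ∀ i j, e' i (e j) = if i = j then 1 else 0)
    (K : ℝ) (hK : ∀ S F : Finset ℕ, S ⊆ F → ∀ a : ℕ → ℝ,
      ‖∑ i ∈ S, a i • e i‖ ≤ K * ‖∑ i ∈ F, a i • e i‖) (i : ℕ) (x : E) :
    |e' i x| ≤ K * ‖x‖ := by
  have := jw_proj e hdense e' he' K hK {i} x
  simpa [norm_smul, hnorm] using this

theorem jw_coord_null (e : ℕ → E) (hdense : Dense (Submodule.span ℝ (Set.range e) : Set E))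
    (hnorm : ∀ i, ‖e i‖ = 1)
    (e' : ℕ → E →L[ℝ] ℝ) (he' : ∀ i j, e' i (e j) = if i = j then 1 else 0)
    (K : ℝ) (hK1 : 1 ≤ K) (hK : ∀ S F : Finset ℕ, S ⊆ F → ∀ a : ℕ → ℝ,
      ‖∑ i ∈ S, a i • e i‖ ≤ K * ‖∑ i ∈ F, a i • e i‖) (x : E) (η : ℝ) (hη : 0 < η) :
    ∃ k, |e' k x| < η := by
  obtain ⟨a, ha⟩ := jw_dense e hdense x (η / K) (by positivity)
  obtain ⟨k, hk⟩ := Infinite.exists_notMem_finset a.support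
  refine ⟨k, ?_⟩
  have h1 := jw_coord_norm e hdense hnorm e' he' K hK k (x - Finsupp.linearCombination ℝ e a)
  rw [map_sub, jw_coord_lc e e' he', Finsupp.notMem_support_iff.1 hk, sub_zero] at h1
  rw [lt_div_iff₀ (by positivity)] at ha
  nlinarith

theorem jw_blocks (e : ℕ → E) (hdense : Dense (Submodule.span ℝ (Set.range e) : Set E))
    (hrefl : IsReflexiveSpace E)
    (e' : ℕ → E →L[ℝ] ℝ) (he' : ∀ i j, e' i (e j) = if i = j then 1 else 0)
    (K : ℝ) (hK1 : 1 ≤ K) (hK : ∀ S F : Finset ℕ, S ⊆ F → ∀ a : ℕ → ℝ,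
      ‖∑ i ∈ S, a i • e i‖ ≤ K * ‖∑ i ∈ F, a i • e i‖)
    (S : ℕ → Finset ℕ) (hS : Pairwise fun k l => Disjoint (S k) (S l)) (b : ℕ → ℝ)
    (δ M : ℝ) (hδ : 0 < δ) (h1 : ∀ k, δ ≤ ‖∑ i ∈ S k, b i • e i‖)
    (h2 : ∀ N, ‖∑ k ∈ Finset.range N, ∑ i ∈ S k, b i • e i‖ ≤ M) : False := by
  set V : ℕ → E := fun N => ∑ k ∈ Finset.range N, ∑ i ∈ S k, b i • e i with hV
  let g : ℕ → WeakDual ℝ (E →L[ℝ] ℝ) :=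
    fun N => StrongDual.toWeakDual (NormedSpace.inclusionInDoubleDual ℝ E (V N))
  have hc := WeakDual.isCompact_closedBall (𝕜 := ℝ) (0 : StrongDual ℝ (E →L[ℝ] ℝ)) M
  obtain ⟨φ, -, hφ⟩ := hc.ultrafilter_le_nhds ((hyperfilter ℕ).map g) (by
    rw [Filter.le_principal_iff]
    refine Filter.mem_map.2 (Filter.univ_mem' fun N => ?_)
    simp only [Set.mem_preimage, mem_closedBall_zero_iff]
    exact (NormedSpace.double_dual_bound ℝ E (V N)).trans (h2 N))
  obtain ⟨x, hx⟩ := hrefl (WeakDual.toStrongDual φ)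
  have hlim : ∀ f : E →L[ℝ] ℝ, Tendsto (fun N => f (V N)) (hyperfilter ℕ) (𝓝 (f x)) := by
    intro f
    have t1 : Tendsto g (hyperfilter ℕ) (𝓝 φ) := hφ
    have t2 := ((WeakDual.eval_continuous f).tendsto φ).comp t1
    have t3 : φ f = f x := by
      have := congrArg (fun ψ => ψ f) hx
      exact this.symm
    rw [t3] at t2
    exact t2
  have hcoef : ∀ k, ∀ i ∈ S k, e' i x = b i := by
    intro k i hi
    refine tendsto_nhds_unique (hlim (e' i)) (tendsto_const_nhds.congr' ?_)
    have : ∀ᶠ N in atTop, b i = e' i (V N) := by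
      filter_upwards [eventually_gt_atTop k] with N hN
      simp only [hV]
      rw [map_sum]
      simp_rw [jw_coord e e' he']
      rw [Finset.sum_eq_single k]
      · rw [if_pos hi]
      · intro l _ hl
        exact if_neg (Finset.disjoint_left.1 (hS hl.symm) hi)
      · intro h; exact absurd (Finset.mem_range.2 hN) h
    have hle : ((hyperfilter ℕ : Ultrafilter ℕ) : Filter ℕ) ≤ atTop := Nat.hyperfilter_le_atTop
    exact hle this
  obtain ⟨a, ha⟩ := jw_dense e hdense x (δ / K) (by positivity)
  -- a block disjoint from the support of a
  obtain ⟨k, hk⟩ : ∃ k, Disjoint (S k) a.support := by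
    by_contra! hcon
    have : ∀ k, ∃ i, i ∈ S k ∧ i ∈ a.support := fun k => Finset.not_disjoint_iff.1 (hcon k)
    choose i hi1 hi2 using this
    have hinj : Function.Injective i := by
      intro k l hkl
      by_contra hne
      exact Finset.disjoint_left.1 (hS hne) (hi1 k) (hkl ▸ hi1 l)
    exact not_injective_infinite_finite (fun k => (⟨i k, hi2 k⟩ : a.support))
      (fun k l h => hinj (by simpa using h))
  have hp := jw_proj e hdense e' he' K hK (S k) (x - Finsupp.linearCombination ℝ e a)
  have : ∑ i ∈ S k, e' i (x - Finsupp.linearCombination ℝ e a) • e i = ∑ i ∈ S k, b i • e i := by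
    refine Finset.sum_congr rfl fun i hi => ?_
    rw [map_sub, hcoef k i hi, jw_coord_lc e e' he',
      Finsupp.notMem_support_iff.1 (Finset.disjoint_left.1 hk hi), sub_zero]
  rw [this] at hp
  rw [lt_div_iff₀ (by positivity)] at ha
  have := h1 k
  nlinarith

theorem jw_up (e : ℕ → E) (p : ℝ) (hp1 : 1 < p) (hup : UpperPEstimate e p) :
    ∃ C : ℝ, 0 ≤ C ∧ ∀ (s : Finset ℕ) (S : ℕ → Finset ℕ) (a : ℕ → ℕ → ℝ),
      (∀ k ∈ s, ∀ l ∈ s, k ≠ l → Disjoint (S k) (S l)) →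
      ‖∑ k ∈ s, ∑ i ∈ S k, a k i • e i‖ ≤
        C * (∑ k ∈ s, ‖∑ i ∈ S k, a k i • e i‖ ^ p) ^ (1 / p) := by
  obtain ⟨C, hC⟩ := hup
  refine ⟨max C 0, le_max_right _ _, fun s S a hd => ?_⟩
  obtain ⟨n, hn⟩ := s.bddAbove
  have hs : s ⊆ Finset.range (n + 1) := fun k hk => Finset.mem_range.2 (Nat.lt_succ_of_le (hn hk))
  set S' : ℕ → Finset ℕ := fun k => if k ∈ s then S k else ∅ with hS'
  have h := hC (n + 1) (fun k => ∑ i ∈ S' k, a k i • e i) S' a (fun _ _ => rfl) (by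
    intro k l _ _ hkl
    simp only [hS']
    by_cases hk : k ∈ s <;> by_cases hl : l ∈ s <;> simp [hk, hl]
    exact hd k hk l hl hkl)
  have e1 : ∑ k ∈ Finset.range (n + 1), ∑ i ∈ S' k, a k i • e i = ∑ k ∈ s, ∑ i ∈ S k, a k i • e i := by
    rw [← Finset.sum_subset hs (fun k _ hk => by simp [hS', hk])]
    refine Finset.sum_congr rfl fun k hk => by simp [hS', hk]
  have e2 : ∑ k ∈ Finset.range (n + 1), ‖∑ i ∈ S' k, a k i • e i‖ ^ p
      = ∑ k ∈ s, ‖∑ i ∈ S k, a k i • e i‖ ^ p := by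
    rw [← Finset.sum_subset hs (fun k _ hk => by
      simp [hS', hk, Real.zero_rpow (by linarith : p ≠ 0)])]
    refine Finset.sum_congr rfl fun k hk => by simp [hS', hk]
  rw [e1, e2] at h
  refine h.trans (mul_le_mul_of_nonneg_right (le_max_left _ _) ?_)
  exact Real.rpow_nonneg (Finset.sum_nonneg fun _ _ => Real.rpow_nonneg (norm_nonneg _) _) _

/-- uniform subsymmetry -/
theorem jw_unif (e : ℕ → E) (hnorm : ∀ i, ‖e i‖ = 1)
    (K : ℝ) (hK1 : 1 ≤ K) (hK : ∀ S F : Finset ℕ, S ⊆ F → ∀ a : ℕ → ℝ,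
      ‖∑ i ∈ S, a i • e i‖ ≤ K * ‖∑ i ∈ F, a i • e i‖)
    (hss : ∀ φ : ℕ → ℕ, StrictMono φ → EquivalentSeq e (e ∘ φ)) :
    ∃ C : ℝ, 1 ≤ C ∧ ∀ (F : Finset ℕ) (g : ℕ → ℕ) (a : ℕ → ℝ), StrictMonoOn g F →
      ‖∑ i ∈ F, a i • e (g i)‖ ≤ C * ‖∑ i ∈ F, a i • e i‖ := by
  by_contra hcon
  push Not at hcon
  -- tail version
  have tail : ∀ (m : ℕ) (C : ℝ), ∃ (F : Finset ℕ) (g : ℕ → ℕ) (a : ℕ → ℝ), StrictMonoOn g F ∧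
      (∀ i ∈ F, m ≤ i ∧ m ≤ g i) ∧ C * ‖∑ i ∈ F, a i • e i‖ < ‖∑ i ∈ F, a i • e (g i)‖ := by
    intro m C
    obtain ⟨F, g, a, hg, h⟩ := hcon (max 1 (|C| * K + 2 * m * K)) (le_max_left _ _)
    set G := F.filter (fun i => ¬ (m ≤ i ∧ m ≤ g i)) with hG
    set F' := F.filter (fun i => m ≤ i ∧ m ≤ g i) with hF'
    have hcard : (G.card : ℝ) ≤ 2 * m := by
      have : G ⊆ (F.filter (fun i => i < m)) ∪ (F.filter (fun i => g i < m)) := by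
        intro i hi
        simp only [hG, Finset.mem_filter, Finset.mem_union] at hi ⊢
        by_cases h1 : m ≤ i
        · right; exact ⟨hi.1, by by_contra h2; exact hi.2 ⟨h1, by omega⟩⟩
        · left; exact ⟨hi.1, by omega⟩
      have c1 : (F.filter (fun i => i < m)).card ≤ m := by
        calc _ ≤ (Finset.range m).card := Finset.card_le_card fun i hi => by
              simpa using (Finset.mem_filter.1 hi).2
          _ = m := Finset.card_range m
      have c2 : (F.filter (fun i => g i < m)).card ≤ m := by
        calc _ ≤ (Finset.range m).card := Finset.card_le_card_of_injOn g (fun i hi => by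
                simpa using (Finset.mem_filter.1 hi).2)
                (hg.injOn.mono (by intro i hi; exact (Finset.mem_filter.1 hi).1))
          _ = m := Finset.card_range m
      have := (Finset.card_le_card this).trans (Finset.card_union_le _ _)
      have h3 : G.card ≤ 2 * m := by omega
      exact_mod_cast h3
    have hsplit : ∑ i ∈ F, a i • e (g i) = ∑ i ∈ F', a i • e (g i) + ∑ i ∈ G, a i • e (g i) :=
      (Finset.sum_filter_add_sum_filter_not F _ _).symm
    have hGb : ‖∑ i ∈ G, a i • e (g i)‖ ≤ 2 * m * K * ‖∑ i ∈ F, a i • e i‖ := by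
      calc _ ≤ ∑ i ∈ G, K * ‖∑ i ∈ F, a i • e i‖ := by
            refine norm_sum_le_of_le _ fun i hi => ?_
            have := hK {i} F (Finset.singleton_subset_iff.2 (Finset.mem_filter.1 hi).1) a
            simpa [norm_smul, hnorm] using this
        _ = G.card * (K * ‖∑ i ∈ F, a i • e i‖) := by simp
        _ ≤ 2 * m * (K * ‖∑ i ∈ F, a i • e i‖) := by gcongr
        _ = _ := by ring
    have hF'b := hK F' F (Finset.filter_subset _ _) a
    refine ⟨F', g, a, hg.mono (by intro i hi; exact (Finset.mem_filter.1 hi).1),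
      fun i hi => (Finset.mem_filter.1 hi).2, ?_⟩
    have t1 := norm_add_le (∑ i ∈ F', a i • e (g i)) (∑ i ∈ G, a i • e (g i))
    rw [← hsplit] at t1
    have t2 : (|C| * K + 2 * m * K) * ‖∑ i ∈ F, a i • e i‖ < ‖∑ i ∈ F, a i • e (g i)‖ :=
      lt_of_le_of_lt (mul_le_mul_of_nonneg_right (le_max_right _ _) (norm_nonneg _)) h
    have t3 : C * ‖∑ i ∈ F', a i • e i‖ ≤ |C| * (K * ‖∑ i ∈ F, a i • e i‖) :=
      mul_le_mul (le_abs_self C) hF'b (norm_nonneg _) (abs_nonneg _)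
    nlinarith
  obtain ⟨f, hf1, hf2⟩ := exists_seq_of_forall_finset_exists
    (α := ℕ × Finset ℕ × (ℕ → ℕ) × (ℕ → ℝ))
    (fun x => StrictMonoOn x.2.2.1 x.2.1 ∧ 
      (x.1 : ℝ) * ‖∑ i ∈ x.2.1, x.2.2.2 i • e i‖ < ‖∑ i ∈ x.2.1, x.2.2.2 i • e (x.2.2.1 i)‖)
    (fun x y => x.1 < y.1 ∧ ∀ i ∈ x.2.1, ∀ j ∈ y.2.1, i < j ∧ x.2.2.1 i < y.2.2.1 j) (by
      intro T hT
      set N : ℕ := T.sup (fun x => x.1) + 1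
      set m : ℕ := T.sup (fun x => x.2.1.sup (fun i => i + x.2.2.1 i)) + 1 with hm
      obtain ⟨F, g, a, hg, h1, h2⟩ := tail m N
      refine ⟨(N, F, g, a), ⟨hg, h2⟩, fun x hx => ⟨?_, ?_⟩⟩
      · have : x.1 ≤ T.sup (fun x => x.1) := Finset.le_sup (f := fun x => x.1) hx
        exact Nat.lt_succ_of_le this
      · intro i hi j hj
        have q1 : i + x.2.2.1 i ≤ x.2.1.sup (fun i => i + x.2.2.1 i) :=
          Finset.le_sup (f := fun i => i + x.2.2.1 i) hi
        have q2 : x.2.1.sup (fun i => i + x.2.2.1 i) ≤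
          T.sup (fun x => x.2.1.sup (fun i => i + x.2.2.1 i)) :=
          Finset.le_sup (f := fun x : ℕ × Finset ℕ × (ℕ → ℕ) × (ℕ → ℝ) =>
            x.2.1.sup (fun i => i + x.2.2.1 i)) hx
        have q3 := h1 j hj
        simp only
        omega)
  set A : Set ℕ := {i | ∃ k, i ∈ (f k).2.1} with hA
  have huniq : ∀ k l i, i ∈ (f k).2.1 → i ∈ (f l).2.1 → k = l := by
    intro k l i hk hl
    rcases lt_trichotomy k l with h | h | h
    · exact absurd ((hf2 k l h).2 i hk i hl).1 (lt_irrefl _)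
    · exact h
    · exact absurd ((hf2 l k h).2 i hl i hk).1 (lt_irrefl _)
  have hne : ∀ k, (f k).2.1.Nonempty := by
    intro k
    by_contra h
    rw [Finset.not_nonempty_iff_eq_empty] at h
    have := (hf1 k).2
    rw [h] at this
    simp at this
  have hAinf : A.Infinite := by
    choose i hi using hne
    refine Set.infinite_of_injective_forall_mem (f := i) (fun k l h => ?_) (fun k => ⟨k, hi k⟩)
    exact huniq k l (i k) (hi k) (h ▸ hi l)
  classical
  set G : ℕ → ℕ := fun i => if h : ∃ k, i ∈ (f k).2.1 then (f h.choose).2.2.1 i else 0 with hG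
  have hGk : ∀ k, ∀ i ∈ (f k).2.1, G i = (f k).2.2.1 i := by
    intro k i hi
    have h : ∃ k, i ∈ (f k).2.1 := ⟨k, hi⟩
    simp only [hG, dif_pos h]
    rw [huniq _ _ i h.choose_spec hi]
  have hGm : StrictMonoOn G A := by
    rintro i ⟨k, hk⟩ j ⟨l, hl⟩ hij
    rw [hGk k i hk, hGk l j hl]
    rcases lt_trichotomy k l with h | h | h
    · exact ((hf2 k l h).2 i hk j hl).2
    · subst h; exact (hf1 k).1 hk hl hij
    · exact absurd ((hf2 l k h).2 j hl i hk).1 (not_lt.2 hij.le)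
  set Φ : ℕ → ℕ := Nat.nth (· ∈ A) with hΦ
  have hΦm : StrictMono Φ := Nat.nth_strictMono hAinf
  have hΦA : ∀ n, Φ n ∈ A := fun n => Nat.nth_mem_of_infinite hAinf n
  have hGΦ : StrictMono (G ∘ Φ) := fun i j h => hGm (hΦA i) (hΦA j) (hΦm h)
  obtain ⟨C1, hC1⟩ := (hss Φ hΦm).2
  obtain ⟨C2, hC2⟩ := (hss (G ∘ Φ) hGΦ).1
  have hge : ∀ k, k ≤ (f k).1 := by
    intro k
    induction k with
    | zero => exact Nat.zero_le _
    | succ k ih => have := (hf2 k (k + 1) (Nat.lt_succ_self k)).1; omega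
  obtain ⟨k, hk⟩ := exists_nat_gt (|C1| * |C2|)
  have hmain := (hf1 k).2
  have hb : (f k).2.1 = ((f k).2.1.image (Nat.count (· ∈ A))).image Φ := by
    ext i
    simp only [Finset.mem_image]
    constructor
    · intro hi
      exact ⟨_, ⟨i, hi, rfl⟩, Nat.nth_count (p := (· ∈ A)) ⟨k, hi⟩⟩
    · rintro ⟨_, ⟨j, hj, rfl⟩, rfl⟩
      rw [hΦ, Nat.nth_count (p := (· ∈ A)) ⟨k, hj⟩]
      exact hj
  set I := (f k).2.1.image (Nat.count (· ∈ A)) with hI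
  have s1 : ∑ i ∈ (f k).2.1, (f k).2.2.2 i • e i = ∑ n ∈ I, (f k).2.2.2 (Φ n) • (e ∘ Φ) n := by
    rw [hb, Finset.sum_image (hΦm.injective.injOn)]; rfl
  have s2 : ∑ i ∈ (f k).2.1, (f k).2.2.2 i • e ((f k).2.2.1 i)
      = ∑ n ∈ I, (f k).2.2.2 (Φ n) • (e ∘ (G ∘ Φ)) n := by
    rw [Finset.sum_congr rfl (fun i hi => by rw [← hGk k i hi])]
    rw [hb, Finset.sum_image (hΦm.injective.injOn)]; rfl
  rw [s1, s2] at hmain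
  set w := ‖∑ n ∈ I, (f k).2.2.2 (Φ n) • (e ∘ Φ) n‖ with hw
  have r1 : ‖∑ n ∈ I, (f k).2.2.2 (Φ n) • e n‖ ≤ C1 * w := hC1 I _
  have r2 := hC2 I (fun n => (f k).2.2.2 (Φ n))
  have hw0 : 0 ≤ w := norm_nonneg _
  have r3 : C2 * ‖∑ n ∈ I, (f k).2.2.2 (Φ n) • e n‖ ≤ |C2| * (|C1| * w) :=
    mul_le_mul (le_abs_self _) (r1.trans (mul_le_mul_of_nonneg_right (le_abs_self _) hw0))
      (norm_nonneg _) (abs_nonneg _)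
  have r4 : (k : ℝ) ≤ ((f k).1 : ℝ) := by exact_mod_cast hge k
  have r5 : (|C1| * |C2|) * w ≤ (f k).1 * w := mul_le_mul_of_nonneg_right (by linarith) hw0
  nlinarith

/-- uniform subsymmetry, two maps -/
theorem jw_unif2 (e : ℕ → E) (C : ℝ) (hC1 : 1 ≤ C)
    (hC : ∀ (F : Finset ℕ) (g : ℕ → ℕ) (a : ℕ → ℝ), StrictMonoOn g F →
      ‖∑ i ∈ F, a i • e (g i)‖ ≤ C * ‖∑ i ∈ F, a i • e i‖)
    (F : Finset ℕ) (g : ℕ → ℕ) (a : ℕ → ℝ) (hg : StrictMonoOn g F) :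
    ‖∑ i ∈ F, a i • e i‖ ≤ C * ‖∑ i ∈ F, a i • e (g i)‖ := by
  classical
  set h : ℕ → ℕ := Function.invFunOn g F with hh
  have hl : ∀ i ∈ F, h (g i) = i := fun i hi => hg.injOn.leftInvOn_invFunOn hi
  have := hC (F.image g) h (fun n => a (h n)) (by
    intro x hx y hy hxy
    obtain ⟨i, hi, rfl⟩ := Finset.mem_image.1 (Finset.mem_coe.1 hx)
    obtain ⟨j, hj, rfl⟩ := Finset.mem_image.1 (Finset.mem_coe.1 hy)
    rw [hl i hi, hl j hj]
    exact (hg.lt_iff_lt hi hj).1 hxy)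
  rw [Finset.sum_image hg.injOn, Finset.sum_image hg.injOn] at this
  rw [Finset.sum_congr rfl (fun i hi => by rw [hl i hi] : ∀ i ∈ F, a (h (g i)) • e (h (g i)) = a i • e i),
    Finset.sum_congr rfl (fun i hi => by rw [hl i hi] : ∀ i ∈ F, a (h (g i)) • e (g i) = a i • e (g i))]
    at this
  exact this

end basis

open Filter Topology

section james
variable {E X : Type*} [NormedAddCommGroup E] [NormedSpace ℝ E]
  [NormedAddCommGroup X] [NormedSpace ℝ X]

structure JW (e : ℕ → E) (u : ℕ → X) (K C : ℝ) : Prop where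
  hK1 : 1 ≤ K
  hC1 : 1 ≤ C
  hnorm : ∀ i, ‖e i‖ = 1
  hK : ∀ S F : Finset ℕ, S ⊆ F → ∀ a : ℕ → ℝ, ‖∑ i ∈ S, a i • e i‖ ≤ K * ‖∑ i ∈ F, a i • e i‖
  hC : ∀ (F : Finset ℕ) (g : ℕ → ℕ) (a : ℕ → ℝ), StrictMonoOn g F →
      ‖∑ i ∈ F, a i • e (g i)‖ ≤ C * ‖∑ i ∈ F, a i • e i‖
  hd : Dense (Submodule.span ℝ (Set.range u) : Set X)
  hn : ∀ a : ℕ →₀ ℝ, ‖Finsupp.linearCombination ℝ u a‖ = jamesNorm e (a : ℕ → ℝ)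

def jwF (D : Finset ℕ) (t : ℕ → ℕ) : Prop := ∀ s ∈ D, ∀ s' ∈ D, s < s' → t s ≤ s'

noncomputable def jwW (e : ℕ → E) (D : Finset ℕ) (t : ℕ → ℕ) (a : ℕ → ℝ) : E :=
  ∑ s ∈ D, (∑ j ∈ Finset.Ico s (t s), a j) • e s

variable {e : ℕ → E} {u : ℕ → X} {K C : ℝ}

theorem JW.upper (h : JW e u K C) (a : ℕ →₀ ℝ) (M : ℝ)
    (hM : ∀ D t, jwF D t → ‖jwW e D t a‖ ≤ M) : ‖Finsupp.linearCombination ℝ u a‖ ≤ M := by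
  rw [h.hn, jamesNorm]
  refine csSup_le ⟨_, 1, id, one_pos, rfl, strictMono_id, rfl⟩ ?_
  rintro x ⟨k, p, hk, hp0, hp, rfl⟩
  set t : ℕ → ℕ := Function.extend p (fun i => p (i + 1)) id with ht
  have htp : ∀ i, t (p i) = p (i + 1) := fun i => hp.injective.extend_apply _ _ i
  have := hM ((Finset.range k).image p) t (by
    intro s hs s' hs' hss
    obtain ⟨i, -, rfl⟩ := Finset.mem_image.1 hs
    obtain ⟨j, -, rfl⟩ := Finset.mem_image.1 hs'
    rw [htp]
    exact hp.monotone (hp.lt_iff_lt.1 hss))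
  rw [jwW, Finset.sum_image hp.injective.injOn] at this
  simpa only [htp] using this

theorem jw_sum_Ico (p : ℕ → ℕ) (hp : StrictMono p) (f : ℕ → ℝ) (k : ℕ) :
    ∑ i ∈ Finset.range k, ∑ j ∈ Finset.Ico (p i) (p (i + 1)), f j
      = ∑ j ∈ Finset.Ico (p 0) (p k), f j := by
  induction k with
  | zero => simp
  | succ k ih =>
    rw [Finset.sum_range_succ, ih, Finset.sum_Ico_consecutive _ (hp.monotone (Nat.zero_le _))
      (hp.monotone (Nat.le_succ _))]

theorem jw_bdd (hnorm : ∀ i, ‖e i‖ = 1) (a : ℕ →₀ ℝ) :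
    BddAbove { x : ℝ | ∃ (k : ℕ) (p : ℕ → ℕ), 0 < k ∧ p 0 = 0 ∧ StrictMono p ∧
    x = ‖∑ i ∈ Finset.range k, (∑ j ∈ Finset.Ico (p i) (p (i + 1)), a j) • e (p i)‖ } := by
  refine ⟨∑ i ∈ a.support, |a i|, ?_⟩
  rintro x ⟨k, p, hk, hp0, hp, rfl⟩
  calc _ ≤ ∑ i ∈ Finset.range k, ∑ j ∈ Finset.Ico (p i) (p (i + 1)), |a j| := by
        refine norm_sum_le_of_le _ fun i _ => ?_
        rw [norm_smul, hnorm, mul_one, Real.norm_eq_abs]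
        exact Finset.abs_sum_le_sum_abs _ _
    _ = ∑ j ∈ Finset.Ico (p 0) (p k), |a j| := jw_sum_Ico p hp _ k
    _ ≤ ∑ j ∈ Finset.Ico (p 0) (p k) ∪ a.support, |a j| :=
        Finset.sum_le_sum_of_subset_of_nonneg Finset.subset_union_left fun _ _ _ => abs_nonneg _
    _ = ∑ i ∈ a.support, |a i| := by
        symm
        refine Finset.sum_subset Finset.subset_union_right fun i _ hi => ?_
        rw [Finsupp.notMem_support_iff.1 hi, abs_zero]

theorem JW.lower (h : JW e u K C) (a : ℕ →₀ ℝ) (D : Finset ℕ) (t : ℕ → ℕ) (hD : jwF D t) :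
    ‖jwW e D t a‖ ≤ K * ‖Finsupp.linearCombination ℝ u a‖ := by
  classical
  set D0 := D.filter (fun s => s < t s) with hD0
  have e0 : jwW e D t a = jwW e D0 t a := by
    rw [jwW, jwW]
    symm
    refine Finset.sum_subset (Finset.filter_subset _ _) fun s hs hs' => ?_
    have : ¬ s < t s := fun hlt => hs' (Finset.mem_filter.2 ⟨hs, hlt⟩)
    rw [Finset.Ico_eq_empty this, Finset.sum_empty, zero_smul]
  rw [e0]
  set N := D0.sup t + 1 with hN
  set A : Set ℕ := {j | j = 0 ∨ (∃ s ∈ D0, j = s ∨ j = t s) ∨ N ≤ j} with hA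
  have hAinf : A.Infinite := by
    refine Set.infinite_of_injective_forall_mem (f := fun k => N + k)
      (fun k l h => by simpa using h) (fun k => Or.inr (Or.inr (Nat.le_add_right _ _)))
  set p := Nat.nth (· ∈ A) with hp
  have hpm : StrictMono p := Nat.nth_strictMono hAinf
  have hpA : ∀ n, p n ∈ A := fun n => Nat.nth_mem_of_infinite hAinf n
  have hp0 : p 0 = 0 := by
    have : Nat.nth (· ∈ A) (Nat.count (· ∈ A) 0) = 0 := Nat.nth_count (p := (· ∈ A)) (Or.inl rfl)
    simpa using this
  have hlt : ∀ s ∈ D0, s < t s := fun s hs => (Finset.mem_filter.1 hs).2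
  have hF0 : ∀ s ∈ D0, ∀ s' ∈ D0, s < s' → t s ≤ s' := fun s hs s' hs' =>
    hD s (Finset.mem_filter.1 hs).1 s' (Finset.mem_filter.1 hs').1
  have htN : ∀ s ∈ D0, t s < N := fun s hs => Nat.lt_succ_of_le (Finset.le_sup hs)
  set c : ℕ → ℕ := Nat.count (· ∈ A) with hc
  have hpc : ∀ s ∈ D0, p (c s) = s := fun s hs =>
    Nat.nth_count (p := (· ∈ A)) (Or.inr (Or.inl ⟨s, hs, Or.inl rfl⟩))
  have hpc1 : ∀ s ∈ D0, p (c s + 1) = t s := by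
    intro s hs
    have h1 : s < p (c s + 1) := by
      have := hpm (Nat.lt_succ_self (c s))
      rwa [hpc s hs] at this
    have h2 : p (c s + 1) ≤ t s := by
      have q1 : p (c (t s)) = t s :=
        Nat.nth_count (p := (· ∈ A)) (Or.inr (Or.inl ⟨s, hs, Or.inr rfl⟩))
      have q2 : c s < c (t s) := by
        have := hlt s hs
        rw [← q1, ← hpc s hs, hpc s hs] at this
        have := hpm.lt_iff_lt.1 ((hpc s hs).trans_lt this)
        exact this
      calc p (c s + 1) ≤ p (c (t s)) := hpm.monotone q2
        _ = t s := q1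
    have h3 := hpA (c s + 1)
    rcases h3 with h3 | ⟨s', hs', h3 | h3⟩ | h3
    · omega
    · have := hF0 s hs s' hs' (by omega)
      omega
    · rcases lt_trichotomy s s' with h4 | h4 | h4
      · have := hF0 s hs s' hs' h4
        have := hlt s' hs'
        omega
      · rw [h3, h4]
      · have := hF0 s' hs' s hs h4
        omega
    · have := htN s hs
      omega
  set k := D0.sup c + 1 with hk
  have hle : ‖∑ i ∈ Finset.range k, (∑ j ∈ Finset.Ico (p i) (p (i + 1)), a j) • e (p i)‖
      ≤ ‖Finsupp.linearCombination ℝ u a‖ := by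
    rw [h.hn, jamesNorm]
    exact le_csSup (jw_bdd h.hnorm a) ⟨k, p, Nat.succ_pos _, hp0, hpm, rfl⟩
  set b : ℕ → ℝ := fun s => ∑ j ∈ Finset.Ico s (p (c s + 1)), a j with hb
  have hcp : ∀ i, c (p i) = i := fun i => Nat.count_nth_of_infinite hAinf i
  have e1 : ∑ i ∈ Finset.range k, (∑ j ∈ Finset.Ico (p i) (p (i + 1)), a j) • e (p i)
      = ∑ s ∈ (Finset.range k).image p, b s • e s := by
    rw [Finset.sum_image hpm.injective.injOn]
    simp only [hb, hcp]
  have e2 : jwW e D0 t a = ∑ s ∈ D0, b s • e s := by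
    rw [jwW]
    refine Finset.sum_congr rfl fun s hs => ?_
    simp only [hb, hpc1 s hs]
  have hsub : D0 ⊆ (Finset.range k).image p := by
    intro s hs
    refine Finset.mem_image.2 ⟨c s, Finset.mem_range.2 (Nat.lt_succ_of_le (Finset.le_sup hs)), hpc s hs⟩
  rw [e2]
  refine (h.hK _ _ hsub b).trans ?_
  rw [← e1]
  exact mul_le_mul_of_nonneg_left hle (by linarith [h.hK1])

theorem jw_lc_range (y : ℕ → X) (a : ℕ →₀ ℝ) (N : ℕ) (hN : ∀ i ∈ a.support, i < N) :
    Finsupp.linearCombination ℝ y a = ∑ i ∈ Finset.range N, a i • y i := by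
  rw [Finsupp.linearCombination_apply, Finsupp.sum]
  refine Finset.sum_subset (fun i hi => Finset.mem_range.2 (hN i hi)) fun i _ hi => ?_
  rw [Finsupp.notMem_support_iff.1 hi, zero_smul]

theorem jw_supp_bound (a : ℕ →₀ ℝ) : ∃ N, ∀ i ∈ a.support, i < N :=
  ⟨a.support.sup id + 1, fun _ hi => Nat.lt_succ_of_le (Finset.le_sup (f := id) hi)⟩

theorem JW.partial_bound (h : JW e u K C) (a : ℕ →₀ ℝ) (n : ℕ) :
    |∑ j ∈ Finset.range n, a j| ≤ K * ‖Finsupp.linearCombination ℝ u a‖ := by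
  have := h.lower a {0} (fun _ => n) (by
    intro s hs s' hs' hss
    simp only [Finset.mem_singleton] at hs hs'
    omega)
  simpa [jwW, norm_smul, h.hnorm] using this

/-- partial summing functionals -/
theorem JW.exists_s (h : JW e u K C) (n : ℕ) :
    ∃ f : X →L[ℝ] ℝ, (∀ i, f (u i) = if i < n then 1 else 0) ∧ ‖f‖ ≤ K := by
  refine jw_ext u h.hd (fun i => if i < n then (1 : ℝ) else 0) K (by linarith [h.hK1]) fun a => ?_
  obtain ⟨N, hN⟩ := jw_supp_bound a
  rw [jw_lc_range _ a (N + n) (fun i hi => by have := hN i hi; omega)]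
  have : ∑ i ∈ Finset.range (N + n), a i • (if i < n then (1 : ℝ) else 0)
      = ∑ j ∈ Finset.range n, a j := by
    simp only [smul_eq_mul, mul_ite, mul_one, mul_zero]
    rw [← Finset.sum_filter]
    congr 1
    ext i; simp; omega
  rw [this]
  exact h.partial_bound a n

theorem JW.exists_S (h : JW e u K C) :
    ∃ f : X →L[ℝ] ℝ, (∀ i, f (u i) = 1) ∧ ‖f‖ ≤ K := by
  refine jw_ext u h.hd (fun _ => (1 : ℝ)) K (by linarith [h.hK1]) fun a => ?_
  obtain ⟨N, hN⟩ := jw_supp_bound a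
  rw [jw_lc_range _ a N hN]
  simpa using h.partial_bound a N

/-- truncation -/
theorem JW.trunc (h : JW e u K C) (a : ℕ →₀ ℝ) (n : ℕ) :
    ‖∑ i ∈ Finset.range n, a i • u i‖ ≤ K * ‖Finsupp.linearCombination ℝ u a‖ := by
  classical
  have e1 : ∑ i ∈ Finset.range n, a i • u i
      = Finsupp.linearCombination ℝ u (a.filter (· < n)) := by
    rw [jw_lc_range u (a.filter (· < n)) n (fun i hi => by
      rw [Finsupp.support_filter] at hi; exact (Finset.mem_filter.1 hi).2)]
    refine Finset.sum_congr rfl fun i hi => ?_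
    rw [Finsupp.filter_apply, if_pos (Finset.mem_range.1 hi)]
  rw [e1]
  refine h.upper _ _ fun D t hD => ?_
  have := h.lower a D (fun s => min (t s) n) (fun s hs s' hs' hss =>
    (min_le_left _ _).trans (hD s hs s' hs' hss))
  convert this using 2
  rw [jwW, jwW]
  refine Finset.sum_congr rfl fun s _ => ?_
  congr 1
  simp only [Finsupp.filter_apply]
  rw [← Finset.sum_filter]
  congr 1
  ext i
  simp only [Finset.mem_filter, Finset.mem_Ico]
  omega

theorem JW.exists_P (h : JW e u K C) [CompleteSpace X] (n : ℕ) :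
    ∃ f : X →L[ℝ] X, (∀ i, f (u i) = if i < n then u i else 0) ∧ ‖f‖ ≤ K := by
  refine jw_ext u h.hd (fun i => if i < n then u i else 0) K (by linarith [h.hK1]) fun a => ?_
  obtain ⟨N, hN⟩ := jw_supp_bound a
  rw [jw_lc_range _ a (N + n) (fun i hi => by have := hN i hi; omega)]
  have : ∑ i ∈ Finset.range (N + n), a i • (if i < n then u i else 0)
      = ∑ j ∈ Finset.range n, a j • u j := by
    simp only [smul_ite, smul_zero]
    rw [← Finset.sum_filter]
    congr 1
    ext i; simp; omega
  rw [this]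
  exact h.trunc a n

/-- selection sums -/
theorem JW.select (h : JW e u K C) (D s : Finset ℕ) (Q : ℕ → ℕ → Prop) [∀ k σ, Decidable (Q k σ)]
    (hQ1 : ∀ k, ∀ σ ∈ D, ∀ σ' ∈ D, Q k σ → Q k σ' → σ = σ')
    (hQ2 : ∀ k l, k < l → ∀ σ ∈ D, ∀ σ' ∈ D, Q k σ → Q l σ' → σ < σ') (c : ℕ → ℝ) :
    ‖∑ σ ∈ D, (∑ k ∈ s, if Q k σ then c k else 0) • e σ‖ ≤ C * K * ‖∑ k ∈ s, c k • e k‖ := by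
  classical
  set G := s.filter (fun k => ∃ σ ∈ D, Q k σ) with hG
  have hex : ∀ k, ∃ σ, k ∈ G → σ ∈ D ∧ Q k σ := by
    intro k
    by_cases hk : k ∈ G
    · obtain ⟨σ, h1, h2⟩ := (Finset.mem_filter.1 hk).2
      exact ⟨σ, fun _ => ⟨h1, h2⟩⟩
    · exact ⟨0, fun h => absurd h hk⟩
  choose g hg using hex
  have e1 : ∑ σ ∈ D, (∑ k ∈ s, if Q k σ then c k else 0) • e σ = ∑ k ∈ G, c k • e (g k) := by
    simp_rw [Finset.sum_smul]
    rw [Finset.sum_comm]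
    symm
    rw [hG, Finset.sum_filter]
    refine Finset.sum_congr rfl fun k hk => ?_
    by_cases hkG : ∃ σ ∈ D, Q k σ
    · have hkG' : k ∈ G := Finset.mem_filter.2 ⟨hk, hkG⟩
      rw [if_pos hkG, Finset.sum_eq_single (g k)]
      · rw [if_pos (hg k hkG').2]
      · intro σ hσ hne
        rw [if_neg, zero_smul]
        intro hq
        exact hne (hQ1 k σ hσ _ (hg k hkG').1 hq (hg k hkG').2)
      · intro hn; exact absurd (hg k hkG').1 hn
    · rw [if_neg hkG]
      symm
      refine Finset.sum_eq_zero fun σ hσ => ?_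
      rw [if_neg (fun hq => hkG ⟨σ, hσ, hq⟩), zero_smul]
  rw [e1]
  calc _ ≤ C * ‖∑ k ∈ G, c k • e k‖ := h.hC G g c (fun k hk l hl hkl =>
        hQ2 k l hkl _ (hg k hk).1 _ (hg l hl).1 (hg k hk).2 (hg l hl).2)
    _ ≤ C * (K * ‖∑ k ∈ s, c k • e k‖) :=
        mul_le_mul_of_nonneg_left (h.hK _ _ (Finset.filter_subset _ _) c) (by linarith [h.hC1])
    _ = _ := by ring

/-- estimate (A) -/
theorem JW.estA (h : JW e u K C) (n : ℕ → ℕ) (hn : StrictMono n) (s : Finset ℕ) (c : ℕ → ℝ) :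
    ‖∑ k ∈ s, c k • (u (n (2 * k)) - u (n (2 * k + 1)))‖ ≤ 2 * (C * K) * ‖∑ k ∈ s, c k • e k‖ := by
  classical
  set a : ℕ →₀ ℝ := ∑ k ∈ s, c k • (Finsupp.single (n (2 * k)) 1 - Finsupp.single (n (2 * k + 1)) 1)
    with ha
  have e1 : ∑ k ∈ s, c k • (u (n (2 * k)) - u (n (2 * k + 1))) = Finsupp.linearCombination ℝ u a := by
    simp [ha, map_sum]
  rw [e1]
  refine h.upper a _ fun D t hD => ?_
  have hn1 : ∀ k, n (2 * k) < n (2 * k + 1) := fun k => hn (by omega)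
  have hn2 : ∀ k l, k < l → n (2 * k + 1) < n (2 * l) := fun k l hkl => hn (by omega)
  have coef : ∀ σ, ∑ j ∈ Finset.Ico σ (t σ), a j =
      (∑ k ∈ s, if (n (2 * k) ∈ Finset.Ico σ (t σ) ∧ n (2 * k + 1) ∉ Finset.Ico σ (t σ))
        then c k else 0) -
      (∑ k ∈ s, if (n (2 * k + 1) ∈ Finset.Ico σ (t σ) ∧ n (2 * k) ∉ Finset.Ico σ (t σ))
        then c k else 0) := by
    intro σ
    simp only [ha, Finsupp.finsetSum_apply, Finsupp.smul_apply, Finsupp.sub_apply, smul_eq_mul]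
    rw [Finset.sum_comm, ← Finset.sum_sub_distrib]
    refine Finset.sum_congr rfl fun k _ => ?_
    rw [← Finset.mul_sum, Finset.sum_sub_distrib]
    simp only [Finsupp.single_apply, Finset.sum_ite_eq]
    by_cases h1 : n (2 * k) ∈ Finset.Ico σ (t σ) <;>
      by_cases h2 : n (2 * k + 1) ∈ Finset.Ico σ (t σ) <;> simp [h1, h2]
  have e2 : jwW e D t a =
      ∑ σ ∈ D, (∑ k ∈ s, if (n (2 * k) ∈ Finset.Ico σ (t σ) ∧ n (2 * k + 1) ∉ Finset.Ico σ (t σ))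
        then c k else 0) • e σ -
      ∑ σ ∈ D, (∑ k ∈ s, if (n (2 * k + 1) ∈ Finset.Ico σ (t σ) ∧ n (2 * k) ∉ Finset.Ico σ (t σ))
        then c k else 0) • e σ := by
    rw [jwW, ← Finset.sum_sub_distrib]
    refine Finset.sum_congr rfl fun σ _ => ?_
    rw [coef, sub_smul]
  have huniq : ∀ m, ∀ σ ∈ D, ∀ σ' ∈ D, m ∈ Finset.Ico σ (t σ) → m ∈ Finset.Ico σ' (t σ') → σ = σ' := by
    intro m σ hσ σ' hσ' h1 h2
    rw [Finset.mem_Ico] at h1 h2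
    rcases lt_trichotomy σ σ' with h3 | h3 | h3
    · have := hD σ hσ σ' hσ' h3; omega
    · exact h3
    · have := hD σ' hσ' σ hσ h3; omega
  have b1 := h.select D s
    (fun k σ => n (2 * k) ∈ Finset.Ico σ (t σ) ∧ n (2 * k + 1) ∉ Finset.Ico σ (t σ))
    (fun k σ hσ σ' hσ' h1 h2 => huniq _ σ hσ σ' hσ' h1.1 h2.1)
    (by
      rintro k l hkl σ hσ σ' hσ' ⟨h1, h2⟩ ⟨h3, h4⟩
      have q1 := hn1 k
      have q2 := hn2 k l hkl
      rw [Finset.mem_Ico] at h1 h2 h3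
      by_contra hcon
      rcases (not_lt.1 hcon).lt_or_eq with h5 | h5
      · have := hD σ' hσ' σ hσ h5; omega
      · subst h5; omega) c
  have b2 := h.select D s
    (fun k σ => n (2 * k + 1) ∈ Finset.Ico σ (t σ) ∧ n (2 * k) ∉ Finset.Ico σ (t σ))
    (fun k σ hσ σ' hσ' h1 h2 => huniq _ σ hσ σ' hσ' h1.1 h2.1)
    (by
      rintro k l hkl σ hσ σ' hσ' ⟨h1, h2⟩ ⟨h3, h4⟩
      have q1 := hn1 l
      have q2 := hn2 k l hkl
      rw [Finset.mem_Ico] at h1 h3 h4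
      omega) c
  rw [e2]
  refine (norm_sub_le _ _).trans ?_
  linarith

/-- operator (B) -/
theorem JW.estB (h : JW e u K C) [CompleteSpace E] (n : ℕ → ℕ) (hn : StrictMono n) :
    ∃ Q : X →L[ℝ] E, ‖Q‖ ≤ C * K ∧ ∀ (e' : ℕ → E →L[ℝ] ℝ),
      (∀ i j, e' i (e j) = if i = j then 1 else 0) → ∀ k i, e' k (Q (u i)) =
        if n (2 * k) ≤ i ∧ i < n (2 * k + 1) then 1 else 0 := by
  classical
  have hC0 : 0 ≤ C := by linarith [h.hC1]
  have hK0 : 0 ≤ K := by linarith [h.hK1]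
  set y : ℕ → E := fun i => ∑ k ∈ Finset.range (i + 1),
    (if n (2 * k) ≤ i ∧ i < n (2 * k + 1) then (1 : ℝ) else 0) • e k with hy
  have hle : ∀ k, k ≤ n (2 * k) := fun k => by
    have := hn.le_apply (x := 2 * k); omega
  have hyN : ∀ i N, i < N → y i = ∑ k ∈ Finset.range N,
    (if n (2 * k) ≤ i ∧ i < n (2 * k + 1) then (1 : ℝ) else 0) • e k := by
    intro i N hi
    refine Finset.sum_subset (fun k hk => ?_) fun k _ hk => ?_
    · rw [Finset.mem_range] at hk ⊢; omega
    · rw [Finset.mem_range] at hk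
      have := hle k
      rw [if_neg (by omega), zero_smul]
  obtain ⟨Q, hQ, hQn⟩ := jw_ext u h.hd y (C * K) (by positivity) (by
    intro a
    obtain ⟨N, hN⟩ := jw_supp_bound a
    have e1 : Finsupp.linearCombination ℝ y a = ∑ k ∈ Finset.range N,
        (∑ j ∈ Finset.Ico (n (2 * k)) (n (2 * k + 1)), a j) • e k := by
      rw [jw_lc_range y a N hN]
      rw [Finset.sum_congr rfl (fun i hi => by rw [hyN i N (Finset.mem_range.1 hi)])]
      simp_rw [Finset.smul_sum]
      rw [Finset.sum_comm]
      refine Finset.sum_congr rfl fun k _ => ?_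
      simp_rw [smul_smul]
      rw [← Finset.sum_smul]
      congr 1
      simp only [mul_ite, mul_one, mul_zero]
      rw [← Finset.sum_filter]
      refine Finset.sum_subset (fun i hi => ?_) fun i hi hi' => ?_
      · simpa using (Finset.mem_filter.1 hi).2
      · by_contra hne
        have := hN i (Finsupp.mem_support_iff.2 hne)
        apply hi'
        rw [Finset.mem_filter]
        exact ⟨Finset.mem_range.2 this, by simpa using hi⟩
    have hg : StrictMono (fun k => n (2 * k)) := fun i j hij => hn (by omega)
    rw [e1]
    have b1 := jw_unif2 e C h.hC1 h.hC (Finset.range N) (fun k => n (2 * k))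
      (fun k => ∑ j ∈ Finset.Ico (n (2 * k)) (n (2 * k + 1)), a j) (hg.strictMonoOn _)
    set t : ℕ → ℕ := Function.extend (fun k => n (2 * k)) (fun k => n (2 * k + 1)) id with ht
    have htn : ∀ k, t (n (2 * k)) = n (2 * k + 1) := fun k => hg.injective.extend_apply _ _ k
    have b2 := h.lower a ((Finset.range N).image (fun k => n (2 * k))) t (by
      intro s hs s' hs' hss
      obtain ⟨i, -, rfl⟩ := Finset.mem_image.1 hs
      obtain ⟨j, -, rfl⟩ := Finset.mem_image.1 hs'
      rw [htn]
      have : i < j := hg.lt_iff_lt.1 hss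
      exact hn.monotone (by omega))
    rw [jwW, Finset.sum_image hg.injective.injOn] at b2
    simp only [htn] at b2
    calc _ ≤ _ := b1
      _ ≤ C * (K * ‖Finsupp.linearCombination ℝ u a‖) := mul_le_mul_of_nonneg_left b2 hC0
      _ = _ := by ring)
  refine ⟨Q, hQn, fun e' he' k i => ?_⟩
  rw [hQ, hyN i (i + k + 1) (by omega), jw_coord e e' he', if_pos (Finset.mem_range.2 (by omega))]

end james

open Filter Topology

section james2
variable {E X : Type*} [NormedAddCommGroup E] [NormedSpace ℝ E]
  [NormedAddCommGroup X] [NormedSpace ℝ X]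
variable {e : ℕ → E} {u : ℕ → X} {K C : ℝ}

theorem jw_ind_lc (y : ℕ → X) (s : Finset ℕ) (a : ℕ → ℝ) :
    Finsupp.linearCombination ℝ y (Finsupp.indicator s (fun i _ => a i)) = ∑ i ∈ s, a i • y i := by
  classical
  rw [Finsupp.linearCombination_apply, Finsupp.sum]
  have hs : (Finsupp.indicator s (fun i _ => a i)).support ⊆ s :=
    Finsupp.support_indicator_subset _ _
  rw [Finset.sum_subset hs (fun i _ hi => by rw [Finsupp.notMem_support_iff.1 hi, zero_smul])]
  refine Finset.sum_congr rfl fun i hi => ?_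
  rw [Finsupp.indicator_of_mem hi]

theorem JW.localize (h : JW e u K C) (a : ℕ → ℝ) (m n : ℕ) (ε : ℝ)
    (hε : ε < ‖∑ i ∈ Finset.Ico m n, a i • u i‖) :
    ∃ D t, jwF D t ∧ (∀ s ∈ D, m ≤ s ∧ t s ≤ n) ∧ ε ≤ C * ‖jwW e D t a‖ := by
  classical
  rw [← jw_ind_lc] at hε
  have : ∃ D t, jwF D t ∧
      ε < ‖jwW e D t (Finsupp.indicator (Finset.Ico m n) (fun i _ => a i))‖ := by
    by_contra hcon
    push Not at hcon
    exact absurd (h.upper _ ε hcon) (not_le.2 hε)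
  obtain ⟨D, t, hD, hlt⟩ := this
  set D0 := D.filter (fun s => max s m < min (t s) n) with hD0
  set g : ℕ → ℕ := fun s => max s m with hg
  have hmem : ∀ s ∈ D0, s ∈ D ∧ max s m < min (t s) n := fun s hs => Finset.mem_filter.1 hs
  have hgm : StrictMonoOn g D0 := by
    intro s hs s' hs' hss
    have h1 := hmem s hs
    have h2 := hmem s' hs'
    have := hD s h1.1 s' h2.1 hss
    simp only [hg]
    omega
  have e1 : jwW e D t (Finsupp.indicator (Finset.Ico m n) (fun i _ => a i))
      = ∑ s ∈ D0, (∑ j ∈ Finset.Ico (max s m) (min (t s) n), a j) • e s := by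
    rw [jwW, hD0, Finset.sum_filter]
    refine Finset.sum_congr rfl fun s _ => ?_
    have : ∑ j ∈ Finset.Ico s (t s), (Finsupp.indicator (Finset.Ico m n) (fun i _ => a i)) j
        = ∑ j ∈ Finset.Ico (max s m) (min (t s) n), a j := by
      simp only [Finsupp.indicator_apply, dite_eq_ite]
      rw [← Finset.sum_filter]
      congr 1
      ext i
      simp only [Finset.mem_filter, Finset.mem_Ico]
      omega
    rw [this]
    split_ifs with hc
    · rfl
    · rw [Finset.Ico_eq_empty hc, Finset.sum_empty, zero_smul]
  set r : ℕ → ℕ := Function.invFunOn g D0 with hr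
  have hrg : ∀ s ∈ D0, r (g s) = s := fun s hs => hgm.injOn.leftInvOn_invFunOn hs
  refine ⟨D0.image g, fun x => min (t (r x)) n, ?_, ?_, ?_⟩
  · intro x hx y hy hxy
    obtain ⟨s, hs, rfl⟩ := Finset.mem_image.1 hx
    obtain ⟨s', hs', rfl⟩ := Finset.mem_image.1 hy
    simp only [hrg s hs]
    have := hD s (hmem s hs).1 s' (hmem s' hs').1 (hgm.lt_iff_lt hs hs' |>.1 hxy)
    simp only [hg]
    omega
  · intro x hx
    obtain ⟨s, hs, rfl⟩ := Finset.mem_image.1 hx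
    exact ⟨le_max_right _ _, min_le_right _ _⟩
  · have b := jw_unif2 e C h.hC1 h.hC D0 g
      (fun s => ∑ j ∈ Finset.Ico (max s m) (min (t s) n), a j) hgm
    rw [← e1] at b
    refine hlt.le.trans (b.trans (le_of_eq ?_))
    rw [jwW, Finset.sum_image hgm.injOn]
    congr 2
    refine Finset.sum_congr rfl fun s hs => ?_
    rw [hrg s hs]

theorem JW.bcomplete (h : JW e u K C) (hdense : Dense (Submodule.span ℝ (Set.range e) : Set E))
    (hrefl : IsReflexiveSpace E)
    (e' : ℕ → E →L[ℝ] ℝ) (he' : ∀ i j, e' i (e j) = if i = j then 1 else 0)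
    (a : ℕ → ℝ) (M : ℝ) (hM : ∀ n, ‖∑ i ∈ Finset.range n, a i • u i‖ ≤ M) :
    CauchySeq (fun n => ∑ i ∈ Finset.range n, a i • u i) := by
  classical
  have hC0 : 0 < C := by linarith [h.hC1]
  have hK0 : 0 ≤ K := by linarith [h.hK1]
  by_contra hcon
  rw [Metric.cauchySeq_iff'] at hcon
  push Not at hcon
  obtain ⟨ε, hε, hcon⟩ := hcon
  obtain ⟨f, hf1, hf2⟩ := exists_seq_of_forall_finset_exists
    (α := Finset ℕ × (ℕ → ℕ)) (fun x => jwF x.1 x.2 ∧ ε / 2 ≤ C * ‖jwW e x.1 x.2 a‖)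
    (fun x y => ∀ s ∈ x.1, ∀ s' ∈ y.1, s < s' ∧ x.2 s ≤ s') (by
      intro F _
      set m := F.sup (fun x => x.1.sup (fun s => s + 1 + x.2 s)) with hm
      obtain ⟨n, hn, hd⟩ := hcon m
      rw [dist_eq_norm, ← Finset.sum_Ico_eq_sub _ hn] at hd
      obtain ⟨D, t, hD, h1, h2⟩ := h.localize a m n (ε / 2) (by linarith)
      refine ⟨(D, t), ⟨hD, h2⟩, fun x hx s hs s' hs' => ?_⟩
      have q1 : s + 1 + x.2 s ≤ m :=
        (Finset.le_sup (f := fun s => s + 1 + x.2 s) hs).trans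
          (Finset.le_sup (f := fun x : Finset ℕ × (ℕ → ℕ) => x.1.sup (fun s => s + 1 + x.2 s)) hx)
      have q2 := (h1 s' hs').1
      omega)
  have hidx : ∀ s, ∃ k, (∃ l, s ∈ (f l).1) → s ∈ (f k).1 := by
    intro s
    by_cases hs : ∃ l, s ∈ (f l).1
    · obtain ⟨l, hl⟩ := hs
      exact ⟨l, fun _ => hl⟩
    · exact ⟨0, fun h => absurd h hs⟩
  choose q hq using hidx
  have hqk : ∀ k, ∀ s ∈ (f k).1, q s = k := by
    intro k s hs
    have h1 := hq s ⟨k, hs⟩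
    rcases lt_trichotomy (q s) k with h2 | h2 | h2
    · exact absurd (hf2 _ _ h2 s h1 s hs).1 (lt_irrefl _)
    · exact h2
    · exact absurd (hf2 _ _ h2 s hs s h1).1 (lt_irrefl _)
  set T : ℕ → ℕ := fun s => (f (q s)).2 s with hT
  have hTk : ∀ k, ∀ s ∈ (f k).1, T s = (f k).2 s := fun k s hs => by
    simp only [hT, hqk k s hs]
  set b : ℕ → ℝ := fun s => ∑ j ∈ Finset.Ico s (T s), a j with hb
  have hWk : ∀ k, jwW e (f k).1 (f k).2 a = ∑ s ∈ (f k).1, b s • e s := by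
    intro k
    rw [jwW]
    refine Finset.sum_congr rfl fun s hs => ?_
    simp only [hb, hTk k s hs]
  have hdisj : Pairwise fun k l => Disjoint (f k).1 (f l).1 := by
    intro k l hkl
    rw [Finset.disjoint_left]
    intro s hs hs'
    exact hkl ((hqk k s hs).symm.trans (hqk l s hs'))
  refine jw_blocks e hdense hrefl e' he' K h.hK1 h.hK (fun k => (f k).1) hdisj b (ε / 2 / C)
    (K * M) (by positivity) (fun k => ?_) (fun N => ?_)
  · rw [div_le_iff₀ hC0, ← hWk, mul_comm]
    exact (hf1 k).2
  · set U := (Finset.range N).biUnion (fun k => (f k).1) with hU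
    have e1 : ∑ k ∈ Finset.range N, ∑ i ∈ (f k).1, b i • e i = ∑ s ∈ U, b s • e s := by
      rw [hU, Finset.sum_biUnion (fun k _ l _ hkl => hdisj hkl)]
    have hUF : jwF U T := by
      intro s hs s' hs' hss
      obtain ⟨k, -, hk⟩ := Finset.mem_biUnion.1 hs
      obtain ⟨l, -, hl⟩ := Finset.mem_biUnion.1 hs'
      rw [hTk k s hk]
      rcases lt_trichotomy k l with h2 | h2 | h2
      · exact (hf2 _ _ h2 s hk s' hl).2
      · subst h2; exact (hf1 k).1 s hk s' hl hss
      · have := (hf2 _ _ h2 s' hl s hk).1; omega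
    set n := U.sup T with hn
    have e2 : jwW e U T (Finsupp.indicator (Finset.range n) (fun i _ => a i))
        = ∑ s ∈ U, b s • e s := by
      rw [jwW]
      refine Finset.sum_congr rfl fun s hs => ?_
      congr 1
      refine Finset.sum_congr rfl fun j hj => ?_
      have : T s ≤ n := Finset.le_sup hs
      rw [Finset.mem_Ico] at hj
      rw [Finsupp.indicator_of_mem (Finset.mem_range.2 (by omega))]
    rw [e1, ← e2]
    refine (h.lower _ U T hUF).trans ?_
    rw [jw_ind_lc]
    exact mul_le_mul_of_nonneg_left (hM n) hK0

/-- upper p-estimate for zero-sum successive blocks -/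
theorem JW.pblocks (h : JW e u K C) (p : ℝ) (hp1 : 1 < p) (Cup : ℝ) (hCup : 0 ≤ Cup)
    (hup : ∀ (s : Finset ℕ) (S : ℕ → Finset ℕ) (a : ℕ → ℕ → ℝ),
      (∀ k ∈ s, ∀ l ∈ s, k ≠ l → Disjoint (S k) (S l)) →
      ‖∑ k ∈ s, ∑ i ∈ S k, a k i • e i‖ ≤
        Cup * (∑ k ∈ s, ‖∑ i ∈ S k, a k i • e i‖ ^ p) ^ (1 / p))
    (x : ℕ → ℕ →₀ ℝ) (B : ℝ) (hB : ∀ k, ‖Finsupp.linearCombination ℝ u (x k)‖ ≤ B)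
    (hs0 : ∀ k, ∑ i ∈ (x k).support, x k i = 0)
    (hsucc : ∀ k l, k < l → ∀ i ∈ (x k).support, ∀ j ∈ (x l).support, i < j) (N : ℕ) :
    ‖∑ k ∈ Finset.range N, Finsupp.linearCombination ℝ u (x k)‖
      ≤ 2 * (Cup * (K * B)) * (N : ℝ) ^ (1 / p) := by
  classical
  have hp0 : 0 < p := by linarith
  have hK0 : 0 ≤ K := by linarith [h.hK1]
  have hB0 : 0 ≤ B := (norm_nonneg _).trans (hB 0)
  rw [← map_sum]
  refine h.upper _ _ fun D t hD => ?_
  set c : ℕ → ℕ → ℝ := fun k s => ∑ j ∈ Finset.Ico s (t s), x k j with hc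
  have hcne : ∀ k s, c k s ≠ 0 → ∃ j ∈ (x k).support, s ≤ j ∧ j < t s := by
    intro k s hne
    obtain ⟨j, hj, hj'⟩ := Finset.exists_ne_zero_of_sum_ne_zero hne
    exact ⟨j, Finsupp.mem_support_iff.2 hj', Finset.mem_Ico.1 hj⟩
  set L : ℕ → Finset ℕ := fun k => D.filter (fun s => c k s ≠ 0 ∧ ∃ i ∈ (x k).support, i < s)
    with hL
  set R : ℕ → Finset ℕ := fun k => D.filter (fun s => c k s ≠ 0 ∧ ¬ ∃ i ∈ (x k).support, i < s)
    with hR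
  have hRr : ∀ k, ∀ s ∈ R k, ∃ i ∈ (x k).support, t s ≤ i := by
    intro k s hs
    obtain ⟨-, h1, h2⟩ := Finset.mem_filter.1 hs
    by_contra hno
    push Not at hno h2
    apply h1
    rw [← hs0 k]
    symm
    refine Finset.sum_subset (fun i hi => Finset.mem_Ico.2 ⟨h2 i hi, hno i hi⟩) fun i _ hi =>
      Finsupp.notMem_support_iff.1 hi
  have hLd : ∀ k l, k < l → Disjoint (L k) (L l) := by
    intro k l hkl
    rw [Finset.disjoint_left]
    intro s h1 h2
    obtain ⟨-, h3, -⟩ := Finset.mem_filter.1 h1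
    obtain ⟨-, -, i, hi, his⟩ := Finset.mem_filter.1 h2
    obtain ⟨j, hj, hsj, -⟩ := hcne k s h3
    have := hsucc k l hkl j hj i hi
    omega
  have hRd : ∀ k l, k < l → Disjoint (R k) (R l) := by
    intro k l hkl
    rw [Finset.disjoint_left]
    intro s h1 h2
    obtain ⟨i, hi, hti⟩ := hRr k s h1
    obtain ⟨-, h3, -⟩ := Finset.mem_filter.1 h2
    obtain ⟨j, hj, -, hjt⟩ := hcne l s h3
    have := hsucc k l hkl i hi j hj
    omega
  have key : ∀ S : ℕ → Finset ℕ, (∀ k, S k ⊆ D) → (∀ k l, k < l → Disjoint (S k) (S l)) →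
      ‖∑ k ∈ Finset.range N, ∑ s ∈ S k, c k s • e s‖ ≤ Cup * (K * B) * (N : ℝ) ^ (1 / p) := by
    intro S hSD hSd
    refine (hup (Finset.range N) S c (fun k _ l _ hkl => ?_)).trans ?_
    · rcases lt_or_gt_of_ne hkl with h1 | h1
      · exact hSd _ _ h1
      · exact (hSd _ _ h1).symm
    · have hk : ∀ k, ‖∑ s ∈ S k, c k s • e s‖ ≤ K * B := fun k =>
        (h.lower (x k) (S k) t (fun s hs s' hs' => hD s (hSD k hs) s' (hSD k hs'))).trans
          (mul_le_mul_of_nonneg_left (hB k) hK0)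
      have h1 : ∑ k ∈ Finset.range N, ‖∑ s ∈ S k, c k s • e s‖ ^ p ≤ N * (K * B) ^ p := by
        refine (Finset.sum_le_card_nsmul _ _ ((K * B) ^ p) fun k _ =>
          Real.rpow_le_rpow (norm_nonneg _) (hk k) hp0.le).trans ?_
        simp
      have h2 : (∑ k ∈ Finset.range N, ‖∑ s ∈ S k, c k s • e s‖ ^ p) ^ (1 / p)
          ≤ (K * B) * (N : ℝ) ^ (1 / p) := by
        refine (Real.rpow_le_rpow (Finset.sum_nonneg fun k _ =>
          Real.rpow_nonneg (norm_nonneg _) _) h1 (by positivity)).trans ?_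
        rw [Real.mul_rpow (by positivity) (by positivity), ← Real.rpow_mul (by positivity),
          mul_one_div_cancel hp0.ne', Real.rpow_one, mul_comm]
      calc _ ≤ Cup * ((K * B) * (N : ℝ) ^ (1 / p)) := mul_le_mul_of_nonneg_left h2 hCup
        _ = _ := by ring
  have e1 : jwW e D t (∑ k ∈ Finset.range N, x k : ℕ →₀ ℝ) =
      ∑ k ∈ Finset.range N, ∑ s ∈ L k, c k s • e s +
      ∑ k ∈ Finset.range N, ∑ s ∈ R k, c k s • e s := by
    rw [← Finset.sum_add_distrib, jwW]
    have : ∀ s, (∑ j ∈ Finset.Ico s (t s), (∑ k ∈ Finset.range N, x k : ℕ →₀ ℝ) j) • e s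
        = ∑ k ∈ Finset.range N, c k s • e s := by
      intro s
      rw [← Finset.sum_smul]
      congr 1
      simp only [hc, Finsupp.finsetSum_apply]
      rw [Finset.sum_comm]
    simp only [this]
    rw [Finset.sum_comm]
    refine Finset.sum_congr rfl fun k _ => ?_
    simp only [hL, hR]
    rw [← Finset.filter_filter, ← Finset.filter_filter, Finset.sum_filter_add_sum_filter_not]
    rw [Finset.sum_filter]
    refine Finset.sum_congr rfl fun s _ => ?_
    split_ifs with h0
    · rfl
    · rw [not_not.1 h0, zero_smul]
  rw [e1]
  refine (norm_add_le _ _).trans ?_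
  have := key L (fun k => Finset.filter_subset _ _) hLd
  have := key R (fun k => Finset.filter_subset _ _) hRd
  linarith

end james2

open Filter Topology

theorem jw_growth (p : ℝ) (hp1 : 1 < p) (δ A : ℝ) (hδ : 0 < δ)
    (h : ∀ N : ℕ, (N : ℝ) * δ ≤ A * (N : ℝ) ^ (1 / p)) : False := by
  have hq : 0 < 1 - 1 / p := by
    rw [sub_pos, div_lt_one (by linarith)]; exact hp1
  have ht := (tendsto_rpow_atTop hq).comp (tendsto_natCast_atTop_atTop (R := ℝ))
  obtain ⟨N, hN1, hN2⟩ := ((ht.eventually_gt_atTop (A / δ)).and (eventually_ge_atTop 1)).exists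
  have hN0 : (0 : ℝ) < N := by exact_mod_cast hN2
  have h1 := h N
  simp only [Function.comp] at hN1
  rw [Real.rpow_sub hN0, Real.rpow_one, div_lt_div_iff₀ hδ (by positivity)] at hN1
  linarith

section james3
variable {E X : Type*} [NormedAddCommGroup E] [NormedSpace ℝ E]
  [NormedAddCommGroup X] [NormedSpace ℝ X]
variable {e : ℕ → E} {u : ℕ → X} {K C : ℝ}

theorem jw_lc_filter (y : ℕ → X) (a : ℕ →₀ ℝ) (Q : ℕ → Prop) [DecidablePred Q] :
    Finsupp.linearCombination ℝ y (a.filter Q) = ∑ i ∈ a.support, if Q i then a i • y i else 0 := by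
  rw [Finsupp.linearCombination_apply, Finsupp.sum, Finsupp.support_filter, ← Finset.sum_filter]
  refine Finset.sum_congr rfl fun i hi => ?_
  rw [Finsupp.filter_apply, if_pos (Finset.mem_filter.1 hi).2]

theorem jw_opdense {Y : Type*} [NormedAddCommGroup Y] [NormedSpace ℝ Y]
    (hd : Dense (Submodule.span ℝ (Set.range u) : Set X)) (g : X →L[ℝ] Y) (c : ℝ) (hc : 0 ≤ c)
    (h : ∀ a : ℕ →₀ ℝ, ‖g (Finsupp.linearCombination ℝ u a)‖ ≤ c * ‖Finsupp.linearCombination ℝ u a‖) :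
    ‖g‖ ≤ c := by
  refine g.opNorm_le_bound hc ?_
  have hcl : IsClosed {x : X | ‖g x‖ ≤ c * ‖x‖} := isClosed_le (by fun_prop) (by fun_prop)
  have : (Submodule.span ℝ (Set.range u) : Set X) ⊆ {x : X | ‖g x‖ ≤ c * ‖x‖} := by
    intro x hx
    have : x ∈ LinearMap.range (Finsupp.linearCombination ℝ u) := by
      rw [Finsupp.range_linearCombination]; exact hx
    obtain ⟨a, rfl⟩ := this
    exact h a
  intro x
  exact hcl.closure_subset_iff.2 this (hd x)

theorem jw_ext_eq {Y : Type*} [NormedAddCommGroup Y] [NormedSpace ℝ Y]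
    (hd : Dense (Submodule.span ℝ (Set.range u) : Set X)) (f g : X →L[ℝ] Y)
    (h : ∀ i, f (u i) = g (u i)) : f = g := by
  have : ‖f - g‖ ≤ 0 := jw_opdense hd (f - g) 0 le_rfl fun a => by
    have : (f - g) (Finsupp.linearCombination ℝ u a) = 0 := by
      rw [Finsupp.linearCombination_apply, Finsupp.sum, map_sum]
      refine Finset.sum_eq_zero fun i _ => ?_
      simp [h]
    rw [this]; simp
  exact sub_eq_zero.1 (norm_le_zero_iff.1 this)

theorem JW.norm_u (h : JW e u K C) (i : ℕ) : ‖u i‖ ≤ C * K := by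
  classical
  have e1 : u i = Finsupp.linearCombination ℝ u (Finsupp.single i 1) := by simp
  rw [e1]
  refine h.upper _ _ fun D t hD => ?_
  have b := h.select D {0} (fun k σ => k = 0 ∧ i ∈ Finset.Ico σ (t σ)) (by
    rintro k σ hσ σ' hσ' ⟨-, h1⟩ ⟨-, h2⟩
    rw [Finset.mem_Ico] at h1 h2
    rcases lt_trichotomy σ σ' with h3 | h3 | h3
    · have := hD σ hσ σ' hσ' h3; omega
    · exact h3
    · have := hD σ' hσ' σ hσ h3; omega) (by
    rintro k l hkl σ hσ σ' hσ' ⟨h1, -⟩ ⟨h2, -⟩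
    omega) (fun _ => 1)
  have e2 : ∑ k ∈ ({0} : Finset ℕ), (1 : ℝ) • e k = e 0 := by simp
  rw [e2, h.hnorm, mul_one] at b
  convert b using 2
  rw [jwW]
  refine Finset.sum_congr rfl fun s _ => ?_
  congr 1
  rw [Finset.sum_singleton]
  simp only [Finsupp.single_apply, Finset.sum_ite_eq, true_and]

theorem JW.shrink (h : JW e u K C) (p : ℝ) (hp1 : 1 < p) (Cup : ℝ) (hCup : 0 ≤ Cup)
    (hup : ∀ (s : Finset ℕ) (S : ℕ → Finset ℕ) (a : ℕ → ℕ → ℝ),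
      (∀ k ∈ s, ∀ l ∈ s, k ≠ l → Disjoint (S k) (S l)) →
      ‖∑ k ∈ s, ∑ i ∈ S k, a k i • e i‖ ≤
        Cup * (∑ k ∈ s, ‖∑ i ∈ S k, a k i • e i‖ ^ p) ^ (1 / p))
    (S : X →L[ℝ] ℝ) (hS : ∀ i, S (u i) = 1) (hSn : ‖S‖ ≤ K)
    (P : ℕ → X →L[ℝ] X) (hP : ∀ n i, P n (u i) = if i < n then u i else 0) (hPn : ∀ n, ‖P n‖ ≤ K)
    (f : X →L[ℝ] ℝ) (hf : Tendsto (fun n => f (u n)) atTop (𝓝 0)) (δ : ℝ) (hδ : 0 < δ) :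
    ∃ m, ∀ n, m ≤ n → ‖f - f.comp (P n)‖ < δ := by
  classical
  by_contra hcon
  push Not at hcon
  have hK0 : 0 < K := by linarith [h.hK1]
  have hC0 : 0 < C := by linarith [h.hC1]
  have hSlc : ∀ a : ℕ →₀ ℝ, S (Finsupp.linearCombination ℝ u a) = ∑ i ∈ a.support, a i := by
    intro a
    rw [Finsupp.linearCombination_apply, Finsupp.sum, map_sum]
    simp [hS]
  set η := δ / (4 * (K * (1 + K))) with hη
  have hη0 : 0 < η := by positivity
  obtain ⟨M0, hM0⟩ := Metric.tendsto_atTop.1 hf η hη0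
  set B := (1 + K) + K * (1 + K) * (C * K) with hB
  obtain ⟨x, hx1, hx2⟩ := exists_seq_of_forall_finset_exists
    (α := ℕ →₀ ℝ) (fun z => ‖Finsupp.linearCombination ℝ u z‖ ≤ B ∧ ∑ i ∈ z.support, z i = 0 ∧
      δ / 4 ≤ f (Finsupp.linearCombination ℝ u z))
    (fun y z => ∀ i ∈ y.support, ∀ j ∈ z.support, i < j) (by
      intro F _
      set m := F.sup (fun y => y.support.sup (fun i => i + 1)) with hm
      obtain ⟨n, hn, hd⟩ := hcon (m + M0)
      set g := f - f.comp (P n) with hg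
      have hex : ∃ a : ℕ →₀ ℝ, δ / 2 * ‖Finsupp.linearCombination ℝ u a‖
          < ‖g (Finsupp.linearCombination ℝ u a)‖ := by
        by_contra hno
        push Not at hno
        have := jw_opdense h.hd g (δ / 2) (by positivity) hno
        linarith
      obtain ⟨a0, ha0⟩ := hex
      have hpos : 0 < ‖Finsupp.linearCombination ℝ u a0‖ := by
        rcases (norm_nonneg (Finsupp.linearCombination ℝ u a0)).lt_or_eq with h1 | h1
        · exact h1
        · rw [norm_eq_zero.1 h1.symm] at ha0
          simp at ha0
      obtain ⟨a, ha1, ha2⟩ : ∃ a : ℕ →₀ ℝ, ‖Finsupp.linearCombination ℝ u a‖ ≤ 1 ∧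
          δ / 2 ≤ g (Finsupp.linearCombination ℝ u a) := by
        set X0 := Finsupp.linearCombination ℝ u a0 with hX0
        rw [Real.norm_eq_abs] at ha0
        rcases abs_cases (g X0) with ⟨h1, -⟩ | ⟨h1, -⟩
        · refine ⟨‖X0‖⁻¹ • a0, ?_, ?_⟩
          · rw [map_smul, norm_smul, norm_inv, norm_norm, inv_mul_cancel₀ hpos.ne']
          · rw [map_smul, map_smul, smul_eq_mul, inv_mul_eq_div, le_div_iff₀ hpos]
            linarith
        · refine ⟨(-‖X0‖⁻¹) • a0, ?_, ?_⟩
          · rw [map_smul, norm_smul, norm_neg, norm_inv, norm_norm, inv_mul_cancel₀ hpos.ne']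
          · rw [map_smul, map_smul, smul_eq_mul, neg_mul, ← mul_neg, inv_mul_eq_div,
              le_div_iff₀ hpos]
            linarith
      set b := a.filter (fun i => ¬ i < n) with hb
      have hbx : Finsupp.linearCombination ℝ u b = Finsupp.linearCombination ℝ u a
          - P n (Finsupp.linearCombination ℝ u a) := by
        rw [hb, jw_lc_filter, Finsupp.linearCombination_apply, Finsupp.sum, map_sum,
          ← Finset.sum_sub_distrib]
        refine Finset.sum_congr rfl fun i _ => ?_
        rw [map_smul, hP]
        by_cases hi : i < n <;> simp [hi]
      have hbn : ‖Finsupp.linearCombination ℝ u b‖ ≤ 1 + K := by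
        rw [hbx]
        refine (norm_sub_le _ _).trans (add_le_add ha1 ?_)
        calc _ ≤ ‖P n‖ * ‖Finsupp.linearCombination ℝ u a‖ := (P n).le_opNorm _
          _ ≤ K * 1 := mul_le_mul (hPn n) ha1 (norm_nonneg _) hK0.le
          _ = K := mul_one _
      have hfb : f (Finsupp.linearCombination ℝ u b) = g (Finsupp.linearCombination ℝ u a) := by
        rw [hbx, map_sub]; rfl
      set σ := S (Finsupp.linearCombination ℝ u b) with hσ
      have hσn : |σ| ≤ K * (1 + K) := by
        calc |σ| ≤ ‖S‖ * ‖Finsupp.linearCombination ℝ u b‖ := S.le_opNorm _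
          _ ≤ K * (1 + K) := mul_le_mul hSn hbn (norm_nonneg _) hK0.le
      have hlz : Finsupp.linearCombination ℝ u (b - σ • Finsupp.single n 1)
          = Finsupp.linearCombination ℝ u b - σ • u n := by
        rw [map_sub, map_smul]; simp
      refine ⟨b - σ • Finsupp.single n 1, ⟨?_, ?_, ?_⟩, ?_⟩
      · rw [hlz]
        refine (norm_sub_le _ _).trans (add_le_add hbn ?_)
        rw [norm_smul]
        exact mul_le_mul hσn (h.norm_u n) (norm_nonneg _) (by positivity)
      · rw [← hSlc, hlz, map_sub, map_smul, hS, ← hσ]; simp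
      · rw [hlz, map_sub, map_smul, hfb, smul_eq_mul]
        have h1 := hM0 n (by omega)
        rw [dist_zero_right, Real.norm_eq_abs] at h1
        have h2 : |σ * f (u n)| ≤ δ / 4 := by
          rw [abs_mul]
          calc |σ| * |f (u n)| ≤ (K * (1 + K)) * η :=
                mul_le_mul hσn h1.le (abs_nonneg _) (by positivity)
            _ = δ / 4 := by rw [hη]; field_simp
        have := (abs_le.1 h2).2
        linarith
      · intro y hy i hi j hj
        have q1 : i + 1 ≤ m :=
          (Finset.le_sup (f := fun i => i + 1) hi).trans
            (Finset.le_sup (f := fun y : ℕ →₀ ℝ => y.support.sup (fun i => i + 1)) hy)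
        have q2 : n ≤ j := by
          by_contra hjn
          rw [Finsupp.mem_support_iff] at hj
          apply hj
          rw [Finsupp.sub_apply, Finsupp.smul_apply, Finsupp.single_apply, if_neg (by omega), hb,
            Finsupp.filter_apply, if_neg (by omega)]
          simp
        omega)
  refine jw_growth p hp1 (δ / 4) (‖f‖ * (2 * (Cup * (K * B)))) (by positivity) fun N => ?_
  have h1 := h.pblocks p hp1 Cup hCup hup x B (fun k => (hx1 k).1) (fun k => (hx1 k).2.1) hx2 N
  have h2 : (N : ℝ) * (δ / 4) ≤ f (∑ k ∈ Finset.range N, Finsupp.linearCombination ℝ u (x k)) := by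
    rw [map_sum]
    have := Finset.card_nsmul_le_sum (Finset.range N)
      (fun k => f (Finsupp.linearCombination ℝ u (x k))) (δ / 4) (fun k _ => (hx1 k).2.2)
    simpa using this
  calc _ ≤ _ := h2
    _ ≤ ‖f‖ * ‖∑ k ∈ Finset.range N, Finsupp.linearCombination ℝ u (x k)‖ :=
        (le_abs_self _).trans (f.le_opNorm _)
    _ ≤ ‖f‖ * (2 * (Cup * (K * B)) * (N : ℝ) ^ (1 / p)) :=
        mul_le_mul_of_nonneg_left h1 (norm_nonneg _)
    _ = _ := by ring

end james3

open Filter Topology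

section james4
variable {E X : Type*} [NormedAddCommGroup E] [NormedSpace ℝ E]
  [NormedAddCommGroup X] [NormedSpace ℝ X]
variable {e : ℕ → E} {u : ℕ → X} {K C : ℝ}

theorem jw_single (hnorm : ∀ i, ‖e i‖ = 1) (p Cup : ℝ)
    (hup : ∀ (s : Finset ℕ) (S : ℕ → Finset ℕ) (a : ℕ → ℕ → ℝ),
      (∀ k ∈ s, ∀ l ∈ s, k ≠ l → Disjoint (S k) (S l)) →
      ‖∑ k ∈ s, ∑ i ∈ S k, a k i • e i‖ ≤
        Cup * (∑ k ∈ s, ‖∑ i ∈ S k, a k i • e i‖ ^ p) ^ (1 / p)) (s : Finset ℕ) (a : ℕ → ℝ) :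
    ‖∑ k ∈ s, a k • e k‖ ≤ Cup * (∑ k ∈ s, |a k| ^ p) ^ (1 / p) := by
  have := hup s (fun k => {k}) (fun _ i => a i) (fun k _ l _ hkl => by simpa using hkl)
  simpa [norm_smul, hnorm] using this

theorem JW.exists_theta (h : JW e u K C) (p : ℝ) (hp1 : 1 < p) (Cup : ℝ)
    (hup : ∀ (s : Finset ℕ) (S : ℕ → Finset ℕ) (a : ℕ → ℕ → ℝ),
      (∀ k ∈ s, ∀ l ∈ s, k ≠ l → Disjoint (S k) (S l)) →
      ‖∑ k ∈ s, ∑ i ∈ S k, a k i • e i‖ ≤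
        Cup * (∑ k ∈ s, ‖∑ i ∈ S k, a k i • e i‖ ^ p) ^ (1 / p)) :
    ∃ θ : (X →L[ℝ] ℝ) →L[ℝ] ℝ, ∀ f : X →L[ℝ] ℝ, Tendsto (fun n => f (u n)) atTop (𝓝 (θ f)) := by
  refine jw_lim u fun f => jw_conv (fun n => f (u n)) (‖f‖ * (C * K)) (fun n => ?_) ?_
  · exact (f.le_opNorm _).trans (mul_le_mul_of_nonneg_left (h.norm_u n) (norm_nonneg _))
  · intro n hn ε hε hk
    have hK0 : 0 < K := by linarith [h.hK1]
    have hC0 : 0 < C := by linarith [h.hC1]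
    refine jw_growth p hp1 ε (‖f‖ * (2 * (C * K)) * Cup) hε fun N => ?_
    have h1 := h.estA n hn (Finset.range N) (fun _ => 1)
    have h2 := jw_single h.hnorm p Cup hup (Finset.range N) (fun _ => 1)
    simp only [abs_one, Real.one_rpow, Finset.sum_const, Finset.card_range, nsmul_eq_mul,
      mul_one] at h2
    have h3 : (N : ℝ) * ε ≤ f (∑ k ∈ Finset.range N, (1 : ℝ) • (u (n (2 * k)) - u (n (2 * k + 1)))) := by
      rw [map_sum]
      have := Finset.card_nsmul_le_sum (Finset.range N)
        (fun k => f ((1 : ℝ) • (u (n (2 * k)) - u (n (2 * k + 1))))) ε (fun k _ => by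
          simpa using hk k)
      simpa using this
    calc _ ≤ _ := h3
      _ ≤ ‖f‖ * ‖∑ k ∈ Finset.range N, (1 : ℝ) • (u (n (2 * k)) - u (n (2 * k + 1)))‖ :=
        (le_abs_self _).trans (f.le_opNorm _)
      _ ≤ ‖f‖ * (2 * (C * K) * (Cup * (N : ℝ) ^ (1 / p))) :=
        mul_le_mul_of_nonneg_left (h1.trans (mul_le_mul_of_nonneg_left h2 (by positivity)))
          (norm_nonneg _)
      _ = _ := by ring

theorem JW.bidual (h : JW e u K C) [CompleteSpace X]
    (hdense : Dense (Submodule.span ℝ (Set.range e) : Set E))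
    (hrefl : IsReflexiveSpace E)
    (e' : ℕ → E →L[ℝ] ℝ) (he' : ∀ i j, e' i (e j) = if i = j then 1 else 0)
    (p : ℝ) (hp1 : 1 < p) (Cup : ℝ) (hCup : 0 ≤ Cup)
    (hup : ∀ (s : Finset ℕ) (S : ℕ → Finset ℕ) (a : ℕ → ℕ → ℝ),
      (∀ k ∈ s, ∀ l ∈ s, k ≠ l → Disjoint (S k) (S l)) →
      ‖∑ k ∈ s, ∑ i ∈ S k, a k i • e i‖ ≤
        Cup * (∑ k ∈ s, ‖∑ i ∈ S k, a k i • e i‖ ^ p) ^ (1 / p))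
    (θ : (X →L[ℝ] ℝ) →L[ℝ] ℝ)
    (hθ : ∀ f : X →L[ℝ] ℝ, Tendsto (fun n => f (u n)) atTop (𝓝 (θ f)))
    (φ : (X →L[ℝ] ℝ) →L[ℝ] ℝ) : ∃ (y : X) (c : ℝ), ∀ f, φ f = f y + c * θ f := by
  have hK0 : 0 < K := by linarith [h.hK1]
  obtain ⟨S, hS, hSn⟩ := h.exists_S
  choose s hs hsn using h.exists_s
  choose P hP hPn using h.exists_P
  set a : ℕ → ℝ := fun i => φ (s (i + 1) - s i) with ha
  have hcomp : ∀ (f : X →L[ℝ] ℝ) n, f.comp (P n)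
      = ∑ i ∈ Finset.range n, f (u i) • (s (i + 1) - s i) := by
    intro f n
    refine jw_ext_eq h.hd _ _ fun j => ?_
    have : ∀ i, (s (i + 1) - s i) (u j) = if j = i then 1 else 0 := by
      intro i
      rw [ContinuousLinearMap.sub_apply, hs, hs]
      rcases lt_trichotomy j i with h1 | h1 | h1
      · rw [if_pos (by omega), if_pos h1, if_neg (by omega), sub_self]
      · rw [if_pos (by omega), if_neg (by omega), if_pos h1, sub_zero]
      · rw [if_neg (by omega), if_neg (by omega), if_neg (by omega), sub_self]
    rw [ContinuousLinearMap.sum_apply]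
    simp only [ContinuousLinearMap.smul_apply, this, ContinuousLinearMap.comp_apply, hP]
    by_cases hj : j < n <;> simp [hj]
  set y : ℕ → X := fun n => ∑ i ∈ Finset.range n, a i • u i with hy
  have hfy : ∀ (f : X →L[ℝ] ℝ) n, φ (f.comp (P n)) = f (y n) := by
    intro f n
    rw [hcomp, map_sum, hy, map_sum]
    refine Finset.sum_congr rfl fun i _ => ?_
    rw [map_smul, map_smul, smul_eq_mul, smul_eq_mul, mul_comm]
  have hyb : ∀ n, ‖y n‖ ≤ K * ‖φ‖ := by
    intro n
    refine NormedSpace.norm_le_dual_bound ℝ _ (by positivity) fun f => ?_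
    rw [← hfy]
    calc _ ≤ ‖φ‖ * ‖f.comp (P n)‖ := φ.le_opNorm _
      _ ≤ ‖φ‖ * (‖f‖ * K) := by
          have hφ0 : 0 ≤ ‖φ‖ := norm_nonneg φ
          refine mul_le_mul_of_nonneg_left ?_ hφ0
          exact (f.opNorm_comp_le _).trans (mul_le_mul_of_nonneg_left (hPn n) (norm_nonneg _))
      _ = _ := by ring
  obtain ⟨x, hx⟩ := cauchySeq_tendsto_of_complete
    (h.bcomplete hdense hrefl e' he' a _ hyb)
  refine ⟨x, φ S - S x, fun f => ?_⟩
  set g := f - θ f • S with hg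
  have hg0 : Tendsto (fun n => g (u n)) atTop (𝓝 0) := by
    have := (hθ f).sub_const (θ f)
    rw [sub_self] at this
    refine this.congr fun n => ?_
    simp [hg, hS]
  have h1 : Tendsto (fun n => g.comp (P n)) atTop (𝓝 g) := by
    rw [Metric.tendsto_atTop]
    intro ε hε
    obtain ⟨m, hm⟩ := h.shrink p hp1 Cup hCup hup S hS hSn P hP hPn g hg0 ε hε
    refine ⟨m, fun n hn => ?_⟩
    rw [dist_eq_norm, norm_sub_rev]
    exact hm n hn
  have h2 : Tendsto (fun n => φ (g.comp (P n))) atTop (𝓝 (φ g)) := (φ.continuous.tendsto g).comp h1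
  have h3 : Tendsto (fun n => φ (g.comp (P n))) atTop (𝓝 (g x)) := by
    simp only [hfy]
    exact (g.continuous.tendsto x).comp hx
  have h4 := tendsto_nhds_unique h2 h3
  simp only [hg, map_sub, map_smul, ContinuousLinearMap.sub_apply, ContinuousLinearMap.smul_apply,
    smul_eq_mul] at h4
  linarith

theorem JW.Qs (h : JW e u K C) [CompleteSpace E]
    (e' : ℕ → E →L[ℝ] ℝ) (he' : ∀ i j, e' i (e j) = if i = j then 1 else 0)
    (s : ℕ → X →L[ℝ] ℝ) (hs : ∀ n i, s n (u i) = if i < n then 1 else 0)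
    (n : ℕ → ℕ) (hn : StrictMono n) : ∃ Q : X →L[ℝ] E, ‖Q‖ ≤ C * K ∧
      ∀ k, (e' k).comp Q = s (n (2 * k + 1)) - s (n (2 * k)) := by
  obtain ⟨Q, hQ, hQe⟩ := h.estB n hn
  refine ⟨Q, hQ, fun k => jw_ext_eq h.hd _ _ fun i => ?_⟩
  rw [ContinuousLinearMap.comp_apply, hQe e' he', ContinuousLinearMap.sub_apply, hs, hs]
  have := hn (show 2 * k < 2 * k + 1 by omega)
  rcases lt_or_ge i (n (2 * k)) with h1 | h1
  · rw [if_neg (by omega), if_pos (by omega), if_pos h1, sub_self]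
  · by_cases h2 : i < n (2 * k + 1)
    · rw [if_pos ⟨h1, h2⟩, if_pos h2, if_neg (by omega), sub_zero]
    · rw [if_neg (by omega), if_neg h2, if_neg (by omega), sub_self]

theorem JW.exists_sigma (h : JW e u K C) [CompleteSpace E]
    (hdense : Dense (Submodule.span ℝ (Set.range e) : Set E))
    (hrefl : IsReflexiveSpace E)
    (e' : ℕ → E →L[ℝ] ℝ) (he' : ∀ i j, e' i (e j) = if i = j then 1 else 0)
    (s : ℕ → X →L[ℝ] ℝ) (hs : ∀ n i, s n (u i) = if i < n then 1 else 0) (hsn : ∀ n, ‖s n‖ ≤ K) :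
    ∃ σ : ((X →L[ℝ] ℝ) →L[ℝ] ℝ) →L[ℝ] ℝ, ∀ φ : (X →L[ℝ] ℝ) →L[ℝ] ℝ,
      Tendsto (fun n => φ (s n)) atTop (𝓝 (σ φ)) := by
  refine jw_lim s fun φ => jw_conv (fun n => φ (s n)) (‖φ‖ * K) (fun n => ?_) ?_
  · exact (φ.le_opNorm _).trans (mul_le_mul_of_nonneg_left (hsn n) (norm_nonneg _))
  · intro n hn ε hε hk
    obtain ⟨Q, -, hQ⟩ := h.Qs e' he' s hs n hn
    obtain ⟨y, hy⟩ := hrefl (φ.comp ((ContinuousLinearMap.compL ℝ X E ℝ).flip Q))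
    obtain ⟨k, hkη⟩ := jw_coord_null e hdense h.hnorm e' he' K h.hK1 h.hK y ε hε
    have h1 : e' k y = φ ((e' k).comp Q) := by
      have := congrArg (fun ψ : (E →L[ℝ] ℝ) →L[ℝ] ℝ => ψ (e' k)) hy
      exact this
    rw [hQ, map_sub] at h1
    have h2 := hk k
    have h3 := (abs_lt.1 hkη).1
    linarith

end james4

/-- Proposition 6 of the paper. -/
theorem statement8 {E X : Type*} [NormedAddCommGroup E] [NormedSpace ℝ E] [CompleteSpace E]
    [NormedAddCommGroup X] [NormedSpace ℝ X] [CompleteSpace X]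
    (e : ℕ → E) (hdense : Dense (Submodule.span ℝ (Set.range e) : Set E))
    (hnorm : ∀ i, ‖e i‖ = 1) (hsub : IsSubsymmetric e) (hrefl : IsReflexiveSpace E)
    (e' : ℕ → E →L[ℝ] ℝ) (he' : ∀ i j, e' i (e j) = if i = j then 1 else 0)
    (p : ℝ) (hp1 : 1 < p)
    (hup : UpperPEstimate e p)
    (hnd : ¬ Dominates e' e)
    (hlp : ¬ ∃ C : ℝ, ∀ (s : Finset ℕ) (a : ℕ → ℝ),
      ‖∑ i ∈ s, a i • e' i‖ ≤ C * (∑ i ∈ s, |a i| ^ p) ^ (1 / p))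
    (u : ℕ → X) (hJ : IsJamesSpace e u) :
    PropertyW X ∧ PropertyW (X →L[ℝ] ℝ) ∧
      ¬ WeaklySeqComplete (X →L[ℝ] ℝ) ∧
      ¬ WeaklySeqComplete ((X →L[ℝ] ℝ) →L[ℝ] ℝ) := by
  obtain ⟨⟨K0, hK0⟩, hss⟩ := hsub
  set K := max K0 1 with hKdef
  have hK1 : 1 ≤ K := le_max_right _ _
  have hKp : 0 < K := by linarith
  have hK : ∀ S F : Finset ℕ, S ⊆ F → ∀ a : ℕ → ℝ,
      ‖∑ i ∈ S, a i • e i‖ ≤ K * ‖∑ i ∈ F, a i • e i‖ := fun S F h a =>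
    (hK0 S F h a).trans (mul_le_mul_of_nonneg_right (le_max_left _ _) (norm_nonneg _))
  obtain ⟨C, hC1, hC⟩ := jw_unif e hnorm K hK1 hK hss
  have h : JW e u K C := ⟨hK1, hC1, hnorm, hK, hC, hJ.1, fun a => by
    rw [← hJ.2 a, Finsupp.linearCombination_apply]; rfl⟩
  obtain ⟨Cup, hCup, hupp⟩ := jw_up e p hp1 hup
  obtain ⟨S, hS, hSn⟩ := h.exists_S
  choose s hs hsn using h.exists_s
  obtain ⟨θ, hθ⟩ := h.exists_theta p hp1 Cup hupp
  have hbid := h.bidual hdense hrefl e' he' p hp1 Cup hCup hupp θ hθ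
  obtain ⟨σ, hσ⟩ := h.exists_sigma hdense hrefl e' he' s hs hsn
  set J : X →L[ℝ] ((X →L[ℝ] ℝ) →L[ℝ] ℝ) := NormedSpace.inclusionInDoubleDual ℝ X with hJdef
  have hJa : ∀ x f, J x f = f x := fun x f => rfl
  have hθs : ∀ n, θ (s n) = 0 := by
    intro n
    refine tendsto_nhds_unique (hθ (s n)) ?_
    refine tendsto_const_nhds.congr' ?_
    filter_upwards [eventually_ge_atTop n] with m hm
    rw [hs, if_neg (by omega)]
  have hθS : θ S = 1 := by
    refine tendsto_nhds_unique (hθ S) ?_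
    simp only [hS]
    exact tendsto_const_nhds
  have hσθ : σ θ = 0 := by
    refine tendsto_nhds_unique (hσ θ) ?_
    simp only [hθs]
    exact tendsto_const_nhds
  have hσJ : σ.comp J = S := by
    refine jw_ext_eq h.hd _ _ fun i => ?_
    rw [hS, ContinuousLinearMap.comp_apply]
    refine tendsto_nhds_unique (hσ (J (u i))) ?_
    refine tendsto_const_nhds.congr' ?_
    filter_upwards [eventually_gt_atTop i] with m hm
    rw [hJa, hs, if_pos hm]
  have hσJx : ∀ x, σ (J x) = S x := fun x => by
    rw [← hσJ]; rfl
  refine ⟨?_, ?_, ?_, ?_⟩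
  · refine jw_abstract u θ hθ hbid e (2 * (C * K)) (fun n hn s c => h.estA n hn s c) ?_
    rintro ⟨K', hK'⟩
    apply hlp
    refine ⟨|K'| * K * Cup, fun t a => ?_⟩
    have h1 := jw_single hnorm p Cup hupp t a
    have h2 : ‖∑ i ∈ t, a i • e' i‖ ≤ |K'| * K * ‖∑ i ∈ t, a i • e i‖ := by
      refine ContinuousLinearMap.opNorm_le_bound _ (by positivity) fun x => ?_
      have q1 := hK' t a (fun i => e' i x)
      have q2 := jw_proj e hdense e' he' K hK t x
      have q3 : (∑ i ∈ t, a i • e' i) x = ∑ i ∈ t, a i * e' i x := by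
        simp [ContinuousLinearMap.sum_apply]
      rw [q3, Real.norm_eq_abs]
      calc _ ≤ _ := q1
        _ ≤ |K'| * (‖∑ i ∈ t, a i • e i‖ * ‖∑ i ∈ t, e' i x • e i‖) :=
          mul_le_mul_of_nonneg_right (le_abs_self _) (by positivity)
        _ ≤ |K'| * (‖∑ i ∈ t, a i • e i‖ * (K * ‖x‖)) := by gcongr
        _ = _ := by ring
    calc _ ≤ _ := h2
      _ ≤ |K'| * K * (Cup * (∑ k ∈ t, |a k| ^ p) ^ (1 / p)) :=
        mul_le_mul_of_nonneg_left h1 (by positivity)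
      _ = _ := by ring
  · refine jw_abstract s σ hσ ?_ e' (C * K) ?_ ?_
    · intro τ
      refine ⟨τ.comp J - (θ (τ.comp J) - τ θ) • S, θ (τ.comp J) - τ θ, fun φ => ?_⟩
      obtain ⟨y, d, hφ⟩ := hbid φ
      have hφ' : φ = J y + d • θ := by
        ext f
        rw [hφ f]; rfl
      rw [hφ', map_add, map_smul, map_add σ, map_smul σ, hσθ, hσJx]
      simp only [ContinuousLinearMap.add_apply, ContinuousLinearMap.smul_apply, hJa, map_sub,
        map_smul, ContinuousLinearMap.sub_apply, smul_eq_mul, hθS, ContinuousLinearMap.comp_apply]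
      ring
    · intro n hn t c
      obtain ⟨Q, hQn, hQ⟩ := h.Qs e' he' s hs n hn
      have q : ∑ k ∈ t, c k • (s (n (2 * k)) - s (n (2 * k + 1)))
          = -((∑ k ∈ t, c k • e' k).comp Q) := by
        have : (∑ k ∈ t, c k • e' k).comp Q = ∑ k ∈ t, c k • (e' k).comp Q := by
          ext x
          simp [ContinuousLinearMap.sum_apply]
        rw [this, ← Finset.sum_neg_distrib]
        refine Finset.sum_congr rfl fun k _ => ?_
        rw [hQ]
        ext x
        simp only [neg_apply, smul_apply, sub_apply, smul_eq_mul]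
        ring
      rw [q, norm_neg, mul_comm]
      exact (ContinuousLinearMap.opNorm_comp_le _ _).trans
        (mul_le_mul_of_nonneg_left hQn (norm_nonneg _))
    · rintro ⟨K', hK'⟩
      apply hnd
      refine ⟨|K'| * K, fun t a => ?_⟩
      refine NormedSpace.norm_le_dual_bound ℝ _ (by positivity) fun f => ?_
      have q1 := hK' t a (fun i => f (e i))
      have q2 : ‖∑ i ∈ t, f (e i) • e' i‖ ≤ ‖f‖ * K := by
        refine ContinuousLinearMap.opNorm_le_bound _ (by positivity) fun x => ?_
        have q3 : (∑ i ∈ t, f (e i) • e' i) x = f (∑ i ∈ t, e' i x • e i) := by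
          simp [ContinuousLinearMap.sum_apply, mul_comm]
        rw [q3, mul_assoc]
        exact (f.le_opNorm _).trans (mul_le_mul_of_nonneg_left
          (jw_proj e hdense e' he' K hK t x) (norm_nonneg _))
      have q4 : f (∑ i ∈ t, a i • e i) = ∑ i ∈ t, a i * f (e i) := by
        simp
      rw [q4, Real.norm_eq_abs]
      calc _ ≤ _ := q1
        _ ≤ |K'| * (‖∑ i ∈ t, a i • e' i‖ * ‖∑ i ∈ t, f (e i) • e' i‖) :=
          mul_le_mul_of_nonneg_right (le_abs_self _) (by positivity)
        _ ≤ |K'| * (‖∑ i ∈ t, a i • e' i‖ * (‖f‖ * K)) := by gcongr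
        _ = _ := by ring
  · intro hw
    obtain ⟨g, hg⟩ := hw s (fun φ => ⟨_, hσ φ⟩)
    have hgS : g = S := by
      refine jw_ext_eq h.hd _ _ fun i => ?_
      rw [← hσJx]
      exact tendsto_nhds_unique (hg (J (u i))) (hσ (J (u i))) 
    have h1 := tendsto_nhds_unique (hg θ) (hσ θ)
    rw [hgS, hθS, hσθ] at h1
    exact one_ne_zero h1
  · intro hw
    obtain ⟨g, hg⟩ := hw (fun n => J (u n)) (fun τ => ⟨_, hθ (τ.comp J)⟩)
    have hgθ : g = θ := by
      ext f
      refine tendsto_nhds_unique (hg (NormedSpace.inclusionInDoubleDual ℝ (X →L[ℝ] ℝ) f)) ?_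
      exact hθ f
    have h1 := hg σ
    simp only [hσJx, hS, hgθ, hσθ] at h1
    exact one_ne_zero (tendsto_nhds_unique tendsto_const_nhds h1)
end

section
/- There exist p with 1 < p < 2 and a reflexive Banach space E with a symmetric normalized unconditional basis (e_i), with biorthogonal functionals (e_i'), such that: E satisfies an upper p-estimate with respect to (e_i); (e_i') does not dominate (e_i); and the unit vector basis of ℓ^p does not dominate (e_i'). -/
open Filter Topology

namespace OrliczEx

/-- the scale sequence -/
noncomputable def dl : ℕ → ℝ
  | 0 => 1
  | (k + 1) => dl k ^ 25 / 2

/-- reciprocals of the scale sequence -/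
def Dl : ℕ → ℕ
  | 0 => 1
  | (k + 1) => 2 * Dl k ^ 25

lemma Dl_pos (k : ℕ) : 0 < Dl k := by
  induction k with
  | zero => simp [Dl]
  | succ k ih => simp only [Dl]; positivity

lemma dl_eq (k : ℕ) : dl k = (Dl k : ℝ)⁻¹ := by
  induction k with
  | zero => simp [Dl, dl]
  | succ k ih => simp only [Dl, dl, ih]; push_cast; field_simp

lemma Dl_ge (k : ℕ) : k + 1 ≤ Dl k := by
  induction k with
  | zero => simp [Dl]
  | succ k ih =>
    simp only [Dl]
    have : Dl k ^ 1 ≤ Dl k ^ 25 := Nat.pow_le_pow_right (Dl_pos k) (by norm_num)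
    rw [pow_one] at this
    omega

lemma dl_pos (k : ℕ) : 0 < dl k := by
  rw [dl_eq]; have := Dl_pos k; positivity

lemma dl_le_one (k : ℕ) : dl k ≤ 1 := by
  rw [dl_eq]
  apply inv_le_one_of_one_le₀
  have := Dl_pos k
  exact_mod_cast this

lemma dl_succ_le (k : ℕ) : dl (k + 1) ≤ dl k / 2 := by
  simp only [dl]
  have : dl k ^ 25 ≤ dl k ^ 1 := pow_le_pow_of_le_one (dl_pos k).le (dl_le_one k) (by norm_num)
  linarith

lemma dl_anti : Antitone dl := antitone_nat_of_succ_le fun k => by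
  have := dl_succ_le k
  have := dl_pos k
  linarith

/-- terms of the basic function -/
noncomputable def hh (k : ℕ) (u : ℝ) : ℝ := 2 * dl k * (u ^ 2 / (dl k ^ 8 + u))

lemma hh_nonneg (k : ℕ) {u : ℝ} (hu : 0 ≤ u) : 0 ≤ hh k u := by
  have := dl_pos k
  unfold hh; positivity

lemma hh_le (k : ℕ) {u : ℝ} (hu : 0 ≤ u) : hh k u ≤ 2 * dl k * u := by
  have := dl_pos k
  unfold hh
  gcongr
  rw [div_le_iff₀ (by positivity)]
  have : 0 ≤ dl k ^ 8 * u := by positivity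
  nlinarith

lemma hh_le' (k : ℕ) {u : ℝ} (hu : 0 ≤ u) : hh k u ≤ 2 * u := by
  refine (hh_le k hu).trans ?_
  have := dl_le_one k
  nlinarith

lemma hh_bdd {u : ℝ} (hu : 0 ≤ u) : BddAbove (Set.range fun k => hh k u) :=
  ⟨2 * u, by rintro _ ⟨k, rfl⟩; exact hh_le' k hu⟩

/-- the basic function -/
noncomputable def HH (u : ℝ) : ℝ := ⨆ k, hh k u

lemma le_HH (k : ℕ) {u : ℝ} (hu : 0 ≤ u) : hh k u ≤ HH u := le_ciSup (hh_bdd hu) k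

lemma HH_nonneg {u : ℝ} (hu : 0 ≤ u) : 0 ≤ HH u := (hh_nonneg 0 hu).trans (le_HH 0 hu)

lemma HH_zero : HH 0 = 0 := by simp [HH, hh]

lemma HH_one : HH 1 = 1 := by
  apply le_antisymm
  · apply ciSup_le
    intro k
    cases k with
    | zero => simp [hh, dl]; norm_num
    | succ k =>
      refine (hh_le _ zero_le_one).trans ?_
      have := dl_succ_le k
      have := dl_le_one k
      linarith
  · refine le_trans ?_ (le_HH 0 zero_le_one)
    simp [hh, dl]; norm_num

lemma HH_upper {u μ : ℝ} (hu : 0 ≤ u) (h0 : 0 ≤ μ) (h1 : μ ≤ 1) : HH (μ * u) ≤ μ * HH u := by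
  apply ciSup_le
  intro k
  refine le_trans ?_ (mul_le_mul_of_nonneg_left (le_HH k hu) h0)
  have := dl_pos k
  unfold hh
  rcases h0.eq_or_lt with rfl | h0
  · simp
  have : (μ * u) ^ 2 / (dl k ^ 8 + μ * u) ≤ μ * (u ^ 2 / (dl k ^ 8 + u)) := by
    rw [← mul_div_assoc, div_le_div_iff₀ (by positivity) (by positivity)]
    have h2 : μ * (dl k ^ 8 + u) ≤ dl k ^ 8 + μ * u := by
      have : 0 < dl k ^ 8 := by positivity
      nlinarith
    calc (μ * u) ^ 2 * (dl k ^ 8 + u) = μ * u ^ 2 * (μ * (dl k ^ 8 + u)) := by ring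
      _ ≤ _ := by gcongr
  nlinarith [mul_le_mul_of_nonneg_left this (show 0 ≤ 2 * dl k by positivity)]

lemma HH_lower {u μ : ℝ} (hu : 0 ≤ u) (h0 : 0 ≤ μ) (h1 : μ ≤ 1) :
    μ ^ 2 * HH u ≤ HH (μ * u) := by
  rw [HH, Real.mul_iSup_of_nonneg (by positivity)]
  apply ciSup_le
  intro k
  refine le_trans ?_ (le_HH k (by positivity))
  have := dl_pos k
  unfold hh
  have : μ ^ 2 * (u ^ 2 / (dl k ^ 8 + u)) ≤ (μ * u) ^ 2 / (dl k ^ 8 + μ * u) := by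
    rw [← mul_div_assoc, mul_pow]
    gcongr
    nlinarith
  nlinarith [mul_le_mul_of_nonneg_left this (show 0 ≤ 2 * dl k by positivity)]

lemma HH_mono {u v : ℝ} (hu : 0 ≤ u) (huv : u ≤ v) : HH u ≤ HH v := by
  rcases (hu.trans huv).eq_or_lt with h | h
  · have : u = v := by linarith
    rw [this]
  · have h2 := HH_upper (u := v) (μ := u / v) h.le (by positivity) (by rw [div_le_one h]; exact huv)
    rw [div_mul_cancel₀ _ h.ne'] at h2
    refine h2.trans (mul_le_of_le_one_left (HH_nonneg h.le) (by rw [div_le_one h]; exact huv))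

lemma titu {a b x y s : ℝ} (hs : 0 < s) (hx : 0 ≤ x) (hy : 0 ≤ y) (ha : 0 ≤ a) (hb : 0 ≤ b)
    (hab : a + b = 1) :
    (a * x + b * y) ^ 2 / (s + (a * x + b * y)) ≤ a * (x ^ 2 / (s + x)) + b * (y ^ 2 / (s + y)) := by
  have e : ∀ z : ℝ, 0 ≤ z → z ^ 2 / (s + z) = z - s + s ^ 2 * (s + z)⁻¹ := by
    intro z hz; have : s + z ≠ 0 := by positivity
    field_simp; ring
  rw [e _ (by positivity), e _ hx, e _ hy]
  have hc := (convexOn_zpow (𝕜 := ℝ) (-1)).2 (show s + x ∈ Set.Ioi 0 by simp; positivity)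
    (show s + y ∈ Set.Ioi 0 by simp; positivity) ha hb hab
  simp only [smul_eq_mul, zpow_neg_one] at hc
  have e2 : a * (s + x) + b * (s + y) = s + (a * x + b * y) := by
    have : b = 1 - a := by linarith
    subst this; ring
  rw [e2] at hc
  have h3 := mul_le_mul_of_nonneg_left hc (sq_nonneg s)
  have hb' : b = 1 - a := by linarith
  subst hb'
  nlinarith

lemma HH_convex {a b x y : ℝ} (hx : 0 ≤ x) (hy : 0 ≤ y) (ha : 0 ≤ a) (hb : 0 ≤ b)
    (hab : a + b = 1) : HH (a * x + b * y) ≤ a * HH x + b * HH y := by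
  apply ciSup_le
  intro k
  have h1 := mul_le_mul_of_nonneg_left (le_HH k hx) ha
  have h2 := mul_le_mul_of_nonneg_left (le_HH k hy) hb
  refine le_trans ?_ (add_le_add h1 h2)
  have := dl_pos k
  have h3 := titu (s := dl k ^ 8) (by positivity) hx hy ha hb hab
  unfold hh
  nlinarith [mul_le_mul_of_nonneg_left h3 (show 0 ≤ 2 * dl k by positivity)]

/-- the Orlicz function -/
noncomputable def MM (t : ℝ) : ℝ := HH (|t| ^ (8 / 5 : ℝ))

lemma MM_nonneg (t : ℝ) : 0 ≤ MM t := HH_nonneg (by positivity)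
lemma MM_zero : MM 0 = 0 := by
  rw [MM, abs_zero, Real.zero_rpow (by norm_num), HH_zero]
lemma MM_one : MM 1 = 1 := by simp [MM, HH_one]
lemma MM_mono {s t : ℝ} (h : |s| ≤ |t|) : MM s ≤ MM t :=
  HH_mono (by positivity) (by gcongr)
lemma MM_abs (t : ℝ) : MM |t| = MM t := by simp [MM]

lemma MM_upper {c : ℝ} (h0 : 0 ≤ c) (h1 : c ≤ 1) (t : ℝ) :
    MM (c * t) ≤ c ^ (8 / 5 : ℝ) * MM t := by
  unfold MM
  rw [abs_mul, abs_of_nonneg h0, Real.mul_rpow h0 (abs_nonneg t)]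
  exact HH_upper (by positivity) (by positivity) (Real.rpow_le_one h0 h1 (by norm_num))

lemma MM_lower {c : ℝ} (h0 : 0 ≤ c) (h1 : c ≤ 1) (t : ℝ) :
    c ^ 4 * MM t ≤ MM (c * t) := by
  unfold MM
  rw [abs_mul, abs_of_nonneg h0, Real.mul_rpow h0 (abs_nonneg t)]
  refine le_trans ?_ (HH_lower (by positivity) (by positivity)
    (Real.rpow_le_one h0 h1 (by norm_num)))
  gcongr
  · exact HH_nonneg (by positivity)
  · rw [show (4 : ℕ) = 2 * 2 by norm_num, pow_mul]
    gcongr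
    rw [← Real.rpow_natCast]
    apply Real.rpow_le_rpow_of_exponent_ge_of_imp h0 h1 (by norm_num)
    intro _ h; norm_num at h

lemma MM_convex : ConvexOn ℝ Set.univ MM := by
  refine ⟨convex_univ, ?_⟩
  intro x _ y _ a b ha hb hab
  simp only [smul_eq_mul]
  unfold MM
  refine le_trans ?_ (HH_convex (by positivity) (by positivity) ha hb hab)
  apply HH_mono (by positivity)
  have h := (convexOn_rpow (p := 8 / 5) (by norm_num)).2 (abs_nonneg x) (abs_nonneg y) ha hb hab
  simp only [smul_eq_mul] at h
  refine le_trans ?_ h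
  gcongr
  refine (abs_add_le _ _).trans ?_
  rw [abs_mul, abs_mul, abs_of_nonneg ha, abs_of_nonneg hb]

lemma MM_pos {t : ℝ} (h : t ≠ 0) : 0 < MM t := by
  have h1 : 0 < |t| ^ (8 / 5 : ℝ) := by positivity
  refine lt_of_lt_of_le ?_ (le_HH 0 h1.le)
  have := dl_pos 0
  unfold hh; positivity

/-- if `MM s ≤ MM t` with `t > 0` then `|s| ≤ |t|`. -/
lemma le_of_MM_le {s t : ℝ} (ht : 0 < t) (h : MM s ≤ MM t) : |s| ≤ t := by
  by_contra! hlt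
  have hs : 0 < |s| := ht.trans hlt
  have h2 := MM_upper (c := t / |s|) (by positivity) (by rw [div_le_one hs]; exact hlt.le) |s|
  rw [div_mul_cancel₀ _ hs.ne', MM_abs] at h2
  have h3 : (t / |s|) ^ (8 / 5 : ℝ) < 1 :=
    Real.rpow_lt_one (by positivity) (by rw [div_lt_one hs]; exact hlt) (by norm_num)
  have h4 := MM_pos ht.ne'
  have h5 : 0 < MM s := MM_pos (by simpa using hs.ne')
  nlinarith

lemma rpow_aux {d : ℝ} (hd : 0 < d) (m : ℕ) : (d ^ (5 * m)) ^ (8 / 5 : ℝ) = d ^ (8 * m) := by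
  rw [← Real.rpow_natCast, ← Real.rpow_mul hd.le, ← Real.rpow_natCast]
  congr 1; push_cast; ring

lemma MM_large (k : ℕ) : dl k ^ 9 ≤ MM (dl k ^ 5) := by
  have hd := dl_pos k
  unfold MM
  rw [abs_of_pos (by positivity), show (5 : ℕ) = 5 * 1 by norm_num, rpow_aux hd]
  refine le_trans ?_ (le_HH k (by positivity))
  unfold hh
  apply le_of_eq
  field_simp
  ring

lemma MM_small (k : ℕ) : MM (dl (k + 1) ^ 20) ≤ dl (k + 1) ^ 56 := by
  have hd := dl_pos (k + 1)
  have hd2 : 2 * dl (k + 1) ≤ 1 := by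
    have := dl_succ_le k
    have := dl_le_one k
    linarith
  set d := dl (k + 1) with hdd
  unfold MM
  rw [abs_of_pos (by positivity), show (20 : ℕ) = 5 * 4 by norm_num, rpow_aux hd]
  apply ciSup_le
  intro j
  rcases le_or_gt j (k + 1) with hj | hj
  · have hj2 : d ≤ dl j := dl_anti hj
    have hj1 := dl_pos j
    have : hh j (d ^ (8 * 4)) ≤ 2 * d ^ 57 := by
      unfold hh
      calc 2 * dl j * ((d ^ (8 * 4)) ^ 2 / (dl j ^ 8 + d ^ (8 * 4)))
          ≤ 2 * dl j * ((d ^ (8 * 4)) ^ 2 / (dl j ^ 8)) := by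
            gcongr
            have : 0 < d ^ (8 * 4) := by positivity
            linarith
        _ = 2 * d ^ 57 * (d ^ 7 / dl j ^ 7) := by field_simp; ring
        _ ≤ 2 * d ^ 57 * 1 := by
            gcongr
            rw [div_le_one (by positivity)]
            gcongr
        _ = _ := by ring
    refine this.trans ?_
    calc 2 * d ^ 57 = 2 * d * d ^ 56 := by ring
      _ ≤ 1 * d ^ 56 := by gcongr
      _ = _ := by ring
  · refine (hh_le j (by positivity)).trans ?_
    have h1 : dl j ≤ dl (k + 2) := dl_anti hj
    have h2 : dl (k + 2) = d ^ 25 / 2 := rfl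
    have h3 : dl j * 2 ≤ d ^ 25 := by linarith
    calc 2 * dl j * d ^ (8 * 4) ≤ d ^ 25 * d ^ (8 * 4) := by gcongr; linarith
      _ = d * d ^ 56 := by ring
      _ ≤ 1 * d ^ 56 := by gcongr; linarith
      _ = _ := by ring


/-- the modular -/
noncomputable def rho (x : ℕ →₀ ℝ) : ℝ := x.sum fun _ t => MM t

lemma rho_eq {x : ℕ →₀ ℝ} {s : Finset ℕ} (h : x.support ⊆ s) : rho x = ∑ i ∈ s, MM (x i) :=
  Finsupp.sum_of_support_subset x h _ fun _ _ => MM_zero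

lemma rho_nonneg (x : ℕ →₀ ℝ) : 0 ≤ rho x := Finset.sum_nonneg fun _ _ => MM_nonneg _

lemma rho_zero : rho 0 = 0 := by simp [rho]

lemma MM_le_rho (x : ℕ →₀ ℝ) (i : ℕ) : MM (x i) ≤ rho x := by
  classical
  rw [rho_eq (Finset.subset_insert i x.support)]
  exact Finset.single_le_sum (f := fun i => MM (x i)) (fun _ _ => MM_nonneg _)
    (Finset.mem_insert_self _ _)

lemma rho_upper {c : ℝ} (h0 : 0 ≤ c) (h1 : c ≤ 1) (x : ℕ →₀ ℝ) :
    rho (c • x) ≤ c ^ (8 / 5 : ℝ) * rho x := by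
  rw [rho_eq (Finsupp.support_smul (b := c) (g := x)), rho_eq subset_rfl, Finset.mul_sum]
  exact Finset.sum_le_sum fun i _ => by simpa using MM_upper h0 h1 (x i)

lemma rho_lower {c : ℝ} (h0 : 0 ≤ c) (h1 : c ≤ 1) (x : ℕ →₀ ℝ) :
    c ^ 4 * rho x ≤ rho (c • x) := by
  rw [rho_eq (Finsupp.support_smul (b := c) (g := x)), rho_eq subset_rfl, Finset.mul_sum]
  exact Finset.sum_le_sum fun i _ => by simpa using MM_lower h0 h1 (x i)

lemma rho_add {x y : ℕ →₀ ℝ} (h : Disjoint x.support y.support) :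
    rho (x + y) = rho x + rho y :=
  Finsupp.sum_add_index_of_disjoint h _

lemma rho_convex {x y : ℕ →₀ ℝ} {a b : ℝ} (ha : 0 ≤ a) (hb : 0 ≤ b) (hab : a + b = 1) :
    rho (a • x + b • y) ≤ a * rho x + b * rho y := by
  classical
  have h1 : (a • x + b • y).support ⊆ x.support ∪ y.support :=
    Finsupp.support_add.trans (Finset.union_subset_union Finsupp.support_smul
      Finsupp.support_smul)
  rw [rho_eq h1, rho_eq (Finset.subset_union_left (s₂ := y.support)),
    rho_eq (Finset.subset_union_right (s₁ := x.support)), Finset.mul_sum, Finset.mul_sum,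
    ← Finset.sum_add_distrib]
  exact Finset.sum_le_sum fun i _ => by
    simpa using MM_convex.2 (Set.mem_univ (x i)) (Set.mem_univ (y i)) ha hb hab

lemma rho_smul_abs (c : ℝ) (x : ℕ →₀ ℝ) : rho (|c| • x) = rho (c • x) := by
  rw [rho_eq (Finsupp.support_smul (b := c) (g := x)),
    rho_eq (Finsupp.support_smul (b := |c|) (g := x))]
  refine Finset.sum_congr rfl fun i _ => ?_
  simp [MM, abs_mul]

/-- the unit ball -/
def BB : Set (ℕ →₀ ℝ) := {x | rho x ≤ 1}

lemma BB_convex : Convex ℝ BB := by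
  intro x hx y hy a b ha hb hab
  refine (rho_convex ha hb hab).trans ?_
  have h1 : rho x ≤ 1 := hx
  have h2 : rho y ≤ 1 := hy
  nlinarith

lemma rho_smul_le {c : ℝ} (h1 : |c| ≤ 1) (x : ℕ →₀ ℝ) : rho (c • x) ≤ rho x := by
  rw [← rho_smul_abs]
  refine (rho_upper (abs_nonneg c) h1 x).trans ?_
  exact mul_le_of_le_one_left (rho_nonneg x) (Real.rpow_le_one (abs_nonneg c) h1 (by norm_num))

lemma BB_balanced : Balanced ℝ BB := by
  intro c hc
  rintro _ ⟨x, hx, rfl⟩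
  exact (rho_smul_le (by simpa using hc) x).trans hx

lemma rho_smul_le_one {c : ℝ} (h0 : 0 ≤ c) (h1 : c ≤ 1) (x : ℕ →₀ ℝ) :
    rho (c • x) ≤ c * rho x := by
  refine (rho_upper h0 h1 x).trans (mul_le_mul_of_nonneg_right ?_ (rho_nonneg x))
  calc c ^ (8 / 5 : ℝ) ≤ c ^ (1 : ℝ) := by
        apply Real.rpow_le_rpow_of_exponent_ge_of_imp h0 h1 (by norm_num)
        intro _ h; norm_num at h
    _ = c := Real.rpow_one c

lemma BB_absorbent : Absorbent ℝ BB := by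
  rw [absorbent_iff_eventually_nhdsNE_zero]
  intro x
  have hp : 0 < (1 + rho x)⁻¹ := by have := rho_nonneg x; positivity
  have : ∀ᶠ c : ℝ in 𝓝 0, |c| < (1 + rho x)⁻¹ := by
    have := Metric.ball_mem_nhds (0 : ℝ) hp
    filter_upwards [this] with c hc
    simpa using hc
  refine (this.filter_mono nhdsWithin_le_nhds).mono fun c hc => ?_
  have h0 := rho_nonneg x
  have hc1 : |c| ≤ 1 := hc.le.trans (inv_le_one_of_one_le₀ (by linarith))
  change rho (c • x) ≤ 1
  rw [← rho_smul_abs]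
  refine (rho_smul_le_one (abs_nonneg c) hc1 x).trans ?_
  calc |c| * rho x ≤ (1 + rho x)⁻¹ * (1 + rho x) := by gcongr; linarith
    _ = 1 := by field_simp

/-- the norm -/
noncomputable def NN : Seminorm ℝ (ℕ →₀ ℝ) := gaugeSeminorm BB_balanced BB_convex BB_absorbent

lemma NN_smul (c : ℝ) (x : ℕ →₀ ℝ) : NN (c • x) = |c| * NN x := by
  simpa using map_smul_eq_mul NN c x

lemma NN_le_one_iff (x : ℕ →₀ ℝ) : NN x ≤ 1 ↔ rho x ≤ 1 := by
  constructor
  · intro h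
    have key : ∀ c : ℝ, 0 < c → c < 1 → c ^ 4 * rho x ≤ 1 := by
      intro c h0 h1
      refine (rho_lower h0.le h1.le x).trans ?_
      have h2 : NN (c • x) < 1 := by
        rw [NN_smul, abs_of_pos h0]
        nlinarith
      exact setOfPred_gauge_lt_one_subset_self BB_convex
        (show rho 0 ≤ 1 by rw [rho_zero]; norm_num) BB_absorbent h2
    have ht : Tendsto (fun c : ℝ => c ^ 4 * rho x) (𝓝[<] 1) (𝓝 (1 ^ 4 * rho x)) :=
      (Continuous.tendsto (by fun_prop) 1).mono_left nhdsWithin_le_nhds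
    rw [one_pow, one_mul] at ht
    refine le_of_tendsto ht ?_
    filter_upwards [Ioo_mem_nhdsLT (show (0 : ℝ) < 1 by norm_num)] with c hc
    exact key c hc.1 hc.2
  · intro h
    exact gauge_le_one_of_mem h

lemma NN_le_iff {c : ℝ} (hc : 0 < c) (x : ℕ →₀ ℝ) : NN x ≤ c ↔ rho (c⁻¹ • x) ≤ 1 := by
  rw [← NN_le_one_iff, NN_smul, abs_of_pos (by positivity), inv_mul_le_iff₀ hc, mul_one]

lemma NN_mono {x y : ℕ →₀ ℝ} (h : ∀ c : ℝ, rho (c • x) ≤ rho (c • y)) : NN x ≤ NN y := by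
  refine le_of_forall_gt_imp_ge_of_dense fun c hc => ?_
  have hc0 : 0 < c := (apply_nonneg NN y).trans_lt hc
  rw [NN_le_iff hc0]
  exact (h _).trans ((NN_le_iff hc0 y).1 hc.le)

lemma coord_le (x : ℕ →₀ ℝ) (i : ℕ) : |x i| ≤ NN x := by
  refine le_of_forall_gt_imp_ge_of_dense fun c hc => ?_
  have hc0 : 0 < c := (apply_nonneg NN x).trans_lt hc
  have h1 := (NN_le_iff hc0 x).1 hc.le
  have h2 := (MM_le_rho (c⁻¹ • x) i).trans h1
  rw [← MM_one] at h2
  have h3 := le_of_MM_le one_pos h2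
  rw [Finsupp.smul_apply, smul_eq_mul, abs_mul, abs_of_pos (by positivity),
    inv_mul_le_iff₀ hc0, mul_one] at h3
  exact h3

lemma eq_zero_of_NN {x : ℕ →₀ ℝ} (h : NN x = 0) : x = 0 := by
  ext i
  have := coord_le x i
  rw [h] at this
  simpa using this

lemma rho_le_rpow {x : ℕ →₀ ℝ} (h : NN x ≤ 1) : rho x ≤ NN x ^ (8 / 5 : ℝ) := by
  rcases (apply_nonneg NN x).eq_or_lt with h0 | h0
  · rw [eq_zero_of_NN h0.symm, rho_zero]
    positivity
  · have h1 := (NN_le_iff h0 x).1 le_rfl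
    have h2 := rho_upper h0.le h ((NN x)⁻¹ • x)
    rw [smul_inv_smul₀ h0.ne'] at h2
    refine h2.trans (mul_le_of_le_one_right (by positivity) h1)

lemma NN_le_of_rho {x : ℕ →₀ ℝ} {c : ℝ} (h0 : 0 < c) (h1 : c ≤ 1) (h : rho x ≤ c ^ 4) :
    NN x ≤ c := by
  rw [NN_le_iff h0]
  have h2 := rho_lower h0.le h1 (c⁻¹ • x)
  rw [smul_inv_smul₀ h0.ne'] at h2
  have h3 : 0 < c ^ 4 := by positivity
  exact le_of_mul_le_mul_left (by linarith) h3

lemma upper_est (n : ℕ) (x : ℕ → ℕ →₀ ℝ)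
    (hd : ∀ k l, k < n → l < n → k ≠ l → Disjoint (x k).support (x l).support) :
    NN (∑ k ∈ Finset.range n, x k) ≤ (∑ k ∈ Finset.range n, NN (x k) ^ (8 / 5 : ℝ)) ^ (5 / 8 : ℝ) := by
  set A := ∑ k ∈ Finset.range n, NN (x k) ^ (8 / 5 : ℝ) with hA
  have hnn : ∀ k ∈ Finset.range n, 0 ≤ NN (x k) ^ (8 / 5 : ℝ) := fun k _ =>
    Real.rpow_nonneg (apply_nonneg NN _) _
  have hA0 : 0 ≤ A := Finset.sum_nonneg hnn
  rcases hA0.eq_or_lt with h0 | h0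
  · have h1 := (Finset.sum_eq_zero_iff_of_nonneg hnn).1 h0.symm
    have h2 : ∀ k ∈ Finset.range n, x k = 0 := fun k hk => by
      apply eq_zero_of_NN
      exact ((Real.rpow_eq_zero (apply_nonneg NN _) (by norm_num)).1 (h1 k hk))
    rw [Finset.sum_eq_zero h2, map_zero]
    positivity
  · have hc : 0 < A ^ (5 / 8 : ℝ) := by positivity
    set c := A ^ (5 / 8 : ℝ) with hcd
    have hcA : c ^ (8 / 5 : ℝ) = A := by
      rw [hcd, ← Real.rpow_mul hA0]; norm_num
    rw [NN_le_iff hc]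
    have hle : ∀ k ∈ Finset.range n, rho (c⁻¹ • x k) ≤ NN (x k) ^ (8 / 5 : ℝ) / A := by
      intro k hk
      have hk1 : NN (x k) ^ (8 / 5 : ℝ) ≤ A := Finset.single_le_sum hnn hk
      have hk2 : NN (x k) ≤ c := by
        rw [← hcA] at hk1
        exact (Real.rpow_le_rpow_iff (apply_nonneg NN _) hc.le (by norm_num)).1 hk1
      have e1 : NN (c⁻¹ • x k) = NN (x k) / c := by
        rw [NN_smul, abs_of_pos (by positivity)]; ring
      have h3 := rho_le_rpow (x := c⁻¹ • x k) (by rw [e1, div_le_one hc]; exact hk2)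
      rwa [e1, Real.div_rpow (apply_nonneg NN _) hc.le, hcA] at h3
    have hsum : ∀ m ≤ n, rho (c⁻¹ • ∑ k ∈ Finset.range m, x k) =
        ∑ k ∈ Finset.range m, rho (c⁻¹ • x k) := by
      classical
      intro m
      induction m with
      | zero => intro _; simp [rho_zero]
      | succ m ih =>
        intro hm
        rw [Finset.sum_range_succ, Finset.sum_range_succ, smul_add, rho_add, ih (by omega)]
        refine Finset.disjoint_of_subset_left Finsupp.support_smul
          (Finset.disjoint_of_subset_right Finsupp.support_smul ?_)
        refine Finset.disjoint_of_subset_left (Finsupp.support_finsetSum) ?_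
        rw [Finset.disjoint_biUnion_left]
        intro k hk
        rw [Finset.mem_range] at hk
        exact hd k m (by omega) (by omega) (by omega)
    rw [hsum n le_rfl]
    refine (Finset.sum_le_sum hle).trans ?_
    rw [← Finset.sum_div, ← hA, div_self h0.ne']

lemma two_est {x y : ℕ →₀ ℝ} (hd : Disjoint x.support y.support) (hx : NN x ≤ 1) (hy : NN y ≤ 1) :
    NN (x + y) ≤ 9 / 5 := by
  rw [NN_le_iff (by norm_num), smul_add, rho_add (Finset.disjoint_of_subset_left
    Finsupp.support_smul (Finset.disjoint_of_subset_right Finsupp.support_smul hd))]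
  have h1 := rho_upper (c := (9 / 5 : ℝ)⁻¹) (by norm_num) (by norm_num) x
  have h2 := rho_upper (c := (9 / 5 : ℝ)⁻¹) (by norm_num) (by norm_num) y
  have h3 := (NN_le_one_iff x).1 hx
  have h4 := (NN_le_one_iff y).1 hy
  have h5 : ((9 / 5 : ℝ)⁻¹) ^ (8 / 5 : ℝ) ≤ 1 / 2 := by
    have : (((9 / 5 : ℝ)⁻¹) ^ (8 / 5 : ℝ)) ^ 5 ≤ (1 / 2) ^ 5 := by
      rw [← Real.rpow_natCast, ← Real.rpow_mul (by norm_num)]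
      norm_num
    exact le_of_pow_le_pow_left₀ (by norm_num) (by norm_num) this
  have h6 : 0 ≤ ((9 / 5 : ℝ)⁻¹) ^ (8 / 5 : ℝ) := by positivity
  have := rho_nonneg x
  have := rho_nonneg y
  nlinarith

/-- functionals have small tails -/
lemma tails (g : (ℕ →₀ ℝ) →ₗ[ℝ] ℝ) {K : ℝ} (hK : ∀ x, |g x| ≤ K * NN x) {ε : ℝ} (hε : 0 < ε) :
    ∃ n : ℕ, ∀ x : ℕ →₀ ℝ, (∀ i ∈ x.support, n ≤ i) → |g x| ≤ ε * NN x := by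
  have key : ∀ c : ℝ, 0 ≤ c →
      (∃ n : ℕ, ∀ x : ℕ →₀ ℝ, (∀ i ∈ x.support, n ≤ i) → |g x| ≤ c * NN x) →
      (∃ n : ℕ, ∀ x : ℕ →₀ ℝ, (∀ i ∈ x.support, n ≤ i) → |g x| ≤ (9 / 10 * c) * NN x) := by
    rintro c hc ⟨n, hn⟩
    by_contra! hcon
    have norm1 : ∀ m : ℕ, ∃ x : ℕ →₀ ℝ, (∀ i ∈ x.support, m ≤ i) ∧ NN x = 1 ∧
        9 / 10 * c < g x := by
      intro m
      obtain ⟨x, hx1, hx2⟩ := hcon m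
      have hp : 0 < NN x := by
        rcases (apply_nonneg NN x).eq_or_lt with h | h
        · rw [eq_zero_of_NN h.symm] at hx2; simp at hx2
        · exact h
      have hg : g x ≠ 0 := by
        intro h0; rw [h0, abs_zero] at hx2
        have : 0 ≤ 9 / 10 * c * NN x := by positivity
        linarith
      refine ⟨((NN x)⁻¹ * SignType.sign (g x)) • x, fun i hi => hx1 i (Finsupp.support_smul hi),
        ?_, ?_⟩
      · have : |((SignType.sign (g x) : SignType) : ℝ)| = 1 := by
          rcases lt_or_gt_of_ne hg with h | h
          · simp [sign_neg h]
          · simp [sign_pos h]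
        rw [NN_smul, abs_mul, this, abs_of_pos (by positivity)]
        field_simp
      · rw [map_smul, smul_eq_mul, mul_assoc, sign_mul_self, ← div_eq_inv_mul, lt_div_iff₀ hp]
        exact hx2
    obtain ⟨x, hx1, hx2, hx3⟩ := norm1 n
    obtain ⟨y, hy1, hy2, hy3⟩ := norm1 (max n (x.support.sup id + 1))
    have hd : Disjoint x.support y.support := by
      rw [Finset.disjoint_left]
      intro i hi hi2
      have h1 := hy1 i hi2
      have h2 : i ≤ x.support.sup id := Finset.le_sup (f := id) hi
      omega
    have h1 := hn (x + y) (by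
      classical
      intro i hi
      rcases Finset.mem_union.1 (Finsupp.support_add hi) with h | h
      · exact hx1 i h
      · exact (le_max_left _ _).trans (hy1 i h))
    have h2 := two_est hd hx2.le hy2.le
    have h3 := (le_abs_self _).trans h1
    rw [map_add] at h3
    have h4 : c * NN (x + y) ≤ c * (9 / 5) := by gcongr
    linarith
  have hK0 : 0 ≤ |K| := abs_nonneg K
  have it : ∀ k : ℕ, ∃ n : ℕ, ∀ x : ℕ →₀ ℝ, (∀ i ∈ x.support, n ≤ i) →
      |g x| ≤ ((9 / 10) ^ k * |K|) * NN x := by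
    intro k
    induction k with
    | zero =>
      refine ⟨0, fun x _ => (hK x).trans ?_⟩
      have := le_abs_self K
      have := apply_nonneg NN x
      rw [pow_zero, one_mul]
      gcongr
    | succ k ih =>
      have := key _ (by positivity) ih
      rw [pow_succ']
      simpa [mul_assoc] using this
  have ht : Tendsto (fun k : ℕ => (9 / 10 : ℝ) ^ k * |K|) atTop (𝓝 (0 * |K|)) :=
    (tendsto_pow_atTop_nhds_zero_of_lt_one (by norm_num) (by norm_num)).mul_const _
  rw [zero_mul] at ht
  obtain ⟨k, hk⟩ := (ht.eventually (gt_mem_nhds hε)).exists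
  obtain ⟨n, hn⟩ := it k
  refine ⟨n, fun x hx => (hn x hx).trans ?_⟩
  have := apply_nonneg NN x
  gcongr


lemma NN_mono_coord {x y : ℕ →₀ ℝ} (h : ∀ i, |x i| ≤ |y i|) : NN x ≤ NN y := by
  classical
  apply NN_mono
  intro c
  rw [rho_eq ((Finsupp.support_smul (b := c) (g := x)).trans
      (Finset.subset_union_left (s₂ := y.support))),
    rho_eq ((Finsupp.support_smul (b := c) (g := y)).trans
      (Finset.subset_union_right (s₁ := x.support)))]
  refine Finset.sum_le_sum fun i _ => MM_mono ?_
  simp only [Finsupp.smul_apply, smul_eq_mul, abs_mul]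
  exact mul_le_mul_of_nonneg_left (h i) (abs_nonneg c)

/-- finite combination of unit vectors -/
noncomputable def fv (τ : ℕ → ℕ) (s : Finset ℕ) (a : ℕ → ℝ) : ℕ →₀ ℝ :=
  ∑ i ∈ s, a i • Finsupp.single (τ i) 1

lemma fv_apply (s : Finset ℕ) (a : ℕ → ℝ) (j : ℕ) : fv id s a j = if j ∈ s then a j else 0 := by
  classical
  simp [fv, Finsupp.finsetSum_apply, Finsupp.single_apply]

lemma fv_support (s : Finset ℕ) (a : ℕ → ℝ) : (fv id s a).support ⊆ s := by
  intro j hj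
  rw [Finsupp.mem_support_iff, fv_apply] at hj
  by_contra h
  simp [h] at hj

lemma rho_fv {τ : ℕ → ℕ} (hτ : Function.Injective τ) (s : Finset ℕ) (a : ℕ → ℝ) :
    rho (fv τ s a) = ∑ i ∈ s, MM (a i) := by
  classical
  induction s using Finset.induction_on with
  | empty => simp [fv, rho_zero]
  | insert j s hj ih =>
    rw [Finset.sum_insert hj, ← ih, fv, Finset.sum_insert hj, rho_add]
    · congr 1
      simp [rho, Finsupp.sum_single_index, MM_zero]
    · refine Finset.disjoint_of_subset_right Finsupp.support_finsetSum ?_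
      rw [Finset.disjoint_biUnion_right]
      intro i hi
      refine Finset.disjoint_of_subset_left Finsupp.support_smul
        (Finset.disjoint_of_subset_right Finsupp.support_smul ?_)
      refine Finset.disjoint_of_subset_left Finsupp.support_single_subset
        (Finset.disjoint_of_subset_right Finsupp.support_single_subset ?_)
      rw [Finset.disjoint_singleton]
      intro h
      exact hj (hτ h ▸ hi)

lemma smul_fv (τ : ℕ → ℕ) (s : Finset ℕ) (a : ℕ → ℝ) (c : ℝ) :
    c • fv τ s a = fv τ s (fun i => c * a i) := by
  simp [fv, Finset.smul_sum]

lemma NN_fv_perm (σ : Equiv.Perm ℕ) (s : Finset ℕ) (a : ℕ → ℝ) :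
    NN (fv σ s a) = NN (fv id s a) := by
  apply le_antisymm <;>
  · apply NN_mono
    intro c
    rw [smul_fv, smul_fv, rho_fv σ.injective, rho_fv Function.injective_id]

lemma NN_single (i : ℕ) : NN (Finsupp.single i 1) = 1 := by
  apply le_antisymm
  · rw [NN_le_one_iff, rho, Finsupp.sum_single_index MM_zero, MM_one]
  · simpa using coord_le (Finsupp.single i 1) i

lemma sum_le_of_MM {n : ℕ} {t : ℝ} (ht : 0 < t) (h : 1 ≤ n * MM t) (z : ℕ →₀ ℝ) :
    |∑ i ∈ Finset.range n, z i| ≤ (n * t) * NN z := by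
  have hn : 0 < (n : ℝ) := by
    rcases Nat.eq_zero_or_pos n with rfl | h0
    · norm_num at h
    · exact_mod_cast h0
  have hnt : 0 < n * t := by positivity
  rw [mul_comm, ← div_le_iff₀ hnt]
  refine le_of_forall_gt_imp_ge_of_dense fun c hc => ?_
  have hc0 : 0 < c := (apply_nonneg NN z).trans_lt hc
  have h1 := (NN_le_iff hc0 z).1 hc.le
  rw [div_le_iff₀ hnt]
  have hJ := MM_convex.map_sum_le (t := Finset.range n) (w := fun _ => (n : ℝ)⁻¹)
    (p := fun i => |(c⁻¹ • z) i|) (fun _ _ => by positivity) (by simp; field_simp)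
    (fun _ _ => Set.mem_univ _)
  simp only [smul_eq_mul, ← Finset.mul_sum, MM_abs] at hJ
  have h2 : ∑ i ∈ Finset.range n, MM ((c⁻¹ • z) i) ≤ rho (c⁻¹ • z) := by
    classical
    rw [rho_eq (Finset.subset_union_left (s₂ := Finset.range n))]
    exact Finset.sum_le_sum_of_subset_of_nonneg Finset.subset_union_right
      fun _ _ _ => MM_nonneg _
  have h3 : MM ((n : ℝ)⁻¹ * ∑ i ∈ Finset.range n, |(c⁻¹ • z) i|) ≤ MM t := by
    refine hJ.trans ?_
    rw [inv_mul_le_iff₀ hn]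
    linarith
  have h4 := (le_abs_self _).trans (le_of_MM_le ht h3)
  rw [inv_mul_le_iff₀ hn] at h4
  have h5 : ∑ i ∈ Finset.range n, |(c⁻¹ • z) i| = c⁻¹ * ∑ i ∈ Finset.range n, |z i| := by
    rw [Finset.mul_sum]
    refine Finset.sum_congr rfl fun i _ => ?_
    rw [Finsupp.smul_apply, smul_eq_mul, abs_mul, abs_of_pos (by positivity)]
  rw [h5, inv_mul_le_iff₀ hc0] at h4
  exact (Finset.abs_sum_le_sum_abs _ _).trans h4

lemma NN_one_ge {n : ℕ} {t : ℝ} (ht : 0 < t) (h : 1 ≤ n * MM t) :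
    1 ≤ t * NN (fv id (Finset.range n) fun _ => 1) := by
  by_contra! hlt
  have e : NN (t • fv id (Finset.range n) fun _ => 1) =
      t * NN (fv id (Finset.range n) fun _ => 1) := by
    rw [NN_smul, abs_of_pos ht]
  rw [← e] at hlt
  have h1 := rho_le_rpow hlt.le
  have h2 := Real.rpow_lt_one (apply_nonneg NN _) hlt (show (0 : ℝ) < 8 / 5 by norm_num)
  rw [smul_fv, rho_fv Function.injective_id] at h1
  simp at h1
  rw [smul_fv] at h2
  simp at h2
  linarith

lemma NN_one_le {n : ℕ} {t : ℝ} (ht : 0 < t) (h : n * MM t ≤ 1) :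
    t * NN (fv id (Finset.range n) fun _ => 1) ≤ 1 := by
  have e : NN (t • fv id (Finset.range n) fun _ => 1) =
      t * NN (fv id (Finset.range n) fun _ => 1) := by
    rw [NN_smul, abs_of_pos ht]
  rw [← e, NN_le_one_iff, smul_fv, rho_fv Function.injective_id]
  simpa using h

lemma exists_compl (V : Type) [AddCommGroup V] [Module ℝ V] (q : Seminorm ℝ V) :
    ∃ (E : Type) (_ : NormedAddCommGroup E) (_ : NormedSpace ℝ E) (_ : CompleteSpace E)
      (J : V →ₗ[ℝ] E), DenseRange J ∧ ∀ x, ‖J x‖ = q x := by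
  let i1 : SeminormedAddCommGroup V := q.toAddGroupSeminorm.toSeminormedAddCommGroup
  let i2 : NormedSpace ℝ V := ⟨fun c x => (map_smul_eq_mul q c x).le⟩
  refine ⟨UniformSpace.Completion V, inferInstance, inferInstance, inferInstance,
    (UniformSpace.Completion.toComplₗᵢ (𝕜 := ℝ) (E := V)).toLinearMap, ?_, ?_⟩
  · exact UniformSpace.Completion.denseRange_coe
  · intro x
    exact UniformSpace.Completion.norm_coe x

section space

variable {E : Type} [NormedAddCommGroup E] [NormedSpace ℝ E] [CompleteSpace E]
  {J : (ℕ →₀ ℝ) →ₗ[ℝ] E}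

/-- unit vectors -/
noncomputable def ee (J : (ℕ →₀ ℝ) →ₗ[ℝ] E) (i : ℕ) : E := J (Finsupp.single i 1)

/-- coordinate functionals -/
noncomputable def cf (J : (ℕ →₀ ℝ) →ₗ[ℝ] E) (i : ℕ) : E →L[ℝ] ℝ :=
  (Finsupp.lapply i : (ℕ →₀ ℝ) →ₗ[ℝ] ℝ).extendOfNorm J

lemma cf_apply (hd : DenseRange J) (hJ : ∀ x, ‖J x‖ = NN x) (i : ℕ) (x : ℕ →₀ ℝ) :
    cf J i (J x) = x i := by
  refine LinearMap.extendOfNorm_eq hd ⟨1, fun y => ?_⟩ x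
  rw [hJ, one_mul]
  exact coord_le y i

lemma sum_ee (τ : ℕ → ℕ) (s : Finset ℕ) (a : ℕ → ℝ) :
    ∑ i ∈ s, a i • ee J (τ i) = J (fv τ s a) := by
  simp only [fv, ee, map_sum, map_smul]

lemma dense_span (hd : DenseRange J) :
    Dense (Submodule.span ℝ (Set.range (ee J)) : Set E) := by
  refine hd.mono ?_
  rintro _ ⟨x, rfl⟩
  induction x using Finsupp.induction_linear with
  | zero => simp
  | add f g hf hg => rw [map_add]; exact Submodule.add_mem _ hf hg
  | single i b =>
    have : J (Finsupp.single i b) = b • ee J i := by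
      rw [ee, ← map_smul, Finsupp.smul_single, smul_eq_mul, mul_one]
    rw [this]
    exact Submodule.smul_mem _ _ (Submodule.subset_span ⟨i, rfl⟩)

lemma opNorm_le (hd : DenseRange J) (hJ : ∀ x, ‖J x‖ = NN x) (f : E →L[ℝ] ℝ) {K : ℝ}
    (hK : 0 ≤ K) (h : ∀ x, |f (J x)| ≤ K * NN x) : ‖f‖ ≤ K := by
  refine f.opNorm_le_bound hK (fun z => ?_)
  refine hd.induction_on (p := fun z => ‖f z‖ ≤ K * ‖z‖) z ?_ ?_
  · exact isClosed_le (by fun_prop) (by fun_prop)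
  · intro x
    rw [hJ]
    exact h x

lemma proj_apply (hd : DenseRange J) (hJ : ∀ x, ‖J x‖ = NN x) (f : E →L[ℝ] ℝ) (s : Finset ℕ)
    (x : ℕ →₀ ℝ) : (∑ i ∈ s, f (ee J i) • cf J i) (J x) = f (J (fv id s x)) := by
  rw [← sum_ee, ContinuousLinearMap.sum_apply, map_sum]
  refine Finset.sum_congr rfl fun i _ => ?_
  simp [cf_apply hd hJ, mul_comm]

lemma proj_norm (hd : DenseRange J) (hJ : ∀ x, ‖J x‖ = NN x) (f : E →L[ℝ] ℝ) (s : Finset ℕ) :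
    ‖∑ i ∈ s, f (ee J i) • cf J i‖ ≤ ‖f‖ := by
  refine opNorm_le hd hJ _ (norm_nonneg f) fun x => ?_
  rw [proj_apply hd hJ]
  refine (f.le_opNorm _).trans ?_
  rw [hJ]
  refine mul_le_mul_of_nonneg_left (NN_mono_coord fun i => ?_) (norm_nonneg f)
  rw [fv_apply]
  split_ifs <;> simp

lemma proj_tendsto (hd : DenseRange J) (hJ : ∀ x, ‖J x‖ = NN x) (f : E →L[ℝ] ℝ) :
    Tendsto (fun n => ∑ i ∈ Finset.range n, f (ee J i) • cf J i) atTop (𝓝 f) := by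
  rw [Metric.tendsto_atTop]
  intro ε hε
  obtain ⟨N, hN⟩ := tails (f.toLinearMap ∘ₗ J) (K := ‖f‖) (fun x => by
    have := f.le_opNorm (J x)
    rw [hJ] at this
    exact this) (half_pos hε)
  refine ⟨N, fun n hn => ?_⟩
  rw [dist_comm, dist_eq_norm]
  refine lt_of_le_of_lt (opNorm_le hd hJ _ (half_pos hε).le fun x => ?_) (half_lt_self hε)
  rw [ContinuousLinearMap.sub_apply, proj_apply hd hJ, ← map_sub, ← map_sub]
  have h1 := hN (x - fv id (Finset.range n) x) (by
    intro i hi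
    rw [Finsupp.mem_support_iff, Finsupp.sub_apply, fv_apply] at hi
    by_contra! h
    exact hi (by simp [h.trans_le hn]))
  refine h1.trans (mul_le_mul_of_nonneg_left (NN_mono_coord fun i => ?_) (half_pos hε).le)
  rw [Finsupp.sub_apply, fv_apply]
  split_ifs <;> simp

lemma bdd_complete (hJ : ∀ x, ‖J x‖ = NN x) (a : ℕ → ℝ) {K : ℝ} (hK : 0 < K)
    (h : ∀ n, ‖∑ i ∈ Finset.range n, a i • ee J i‖ ≤ K) :
    CauchySeq fun n => ∑ i ∈ Finset.range n, a i • ee J i := by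
  have hs : Summable fun i => MM (K⁻¹ * a i) := by
    refine summable_of_sum_range_le (c := 1) (fun _ => MM_nonneg _) fun n => ?_
    have h1 := h n
    have h2 := sum_ee (J := J) id (Finset.range n) a
    simp only [id] at h2
    rw [h2, hJ, NN_le_iff hK, smul_fv, rho_fv Function.injective_id] at h1
    exact h1
  have hs2 := hs.hasSum.tendsto_sum_nat.cauchySeq
  rw [Metric.cauchySeq_iff'] at hs2 ⊢
  intro ε hε
  set c := min 1 (ε / (2 * K)) with hc
  have hc0 : 0 < c := by positivity
  obtain ⟨N, hN⟩ := hs2 (c ^ 4) (by positivity)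
  refine ⟨N, fun n hn => ?_⟩
  have h1 := hN n hn
  rw [Real.dist_eq, ← Finset.sum_Ico_eq_sub _ hn,
    abs_of_nonneg (Finset.sum_nonneg fun _ _ => MM_nonneg _)] at h1
  rw [dist_eq_norm, ← Finset.sum_Ico_eq_sub _ hn]
  have h2 := sum_ee (J := J) id (Finset.Ico N n) a
  simp only [id] at h2
  rw [h2, hJ]
  have h3 : NN (K⁻¹ • fv id (Finset.Ico N n) a) ≤ c := by
    apply NN_le_of_rho hc0 (min_le_left _ _)
    rw [smul_fv, rho_fv Function.injective_id]
    exact h1.le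
  rw [NN_smul, abs_of_pos (by positivity), inv_mul_le_iff₀ hK] at h3
  refine h3.trans_lt ?_
  calc K * c ≤ K * (ε / (2 * K)) := by gcongr; exact min_le_right _ _
    _ = ε / 2 := by field_simp
    _ < ε := half_lt_self hε

lemma reflexive (hd : DenseRange J) (hJ : ∀ x, ‖J x‖ = NN x) : IsReflexiveSpace E := by
  intro φ
  have hb : ∀ (n : ℕ) (f : E →L[ℝ] ℝ), f (∑ i ∈ Finset.range n, φ (cf J i) • ee J i) =
      φ (∑ i ∈ Finset.range n, f (ee J i) • cf J i) := by
    intro n f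
    simp [map_sum, mul_comm]
  have hC := bdd_complete (K := ‖φ‖ + 1) hJ (fun i => φ (cf J i)) (by positivity) (fun n => by
    refine NormedSpace.norm_le_dual_bound ℝ _ (by positivity) fun f => ?_
    rw [hb]
    refine (φ.le_opNorm _).trans ?_
    have := proj_norm hd hJ f (Finset.range n)
    gcongr
    linarith)
  obtain ⟨x, hx⟩ := cauchySeq_tendsto_of_complete hC
  refine ⟨x, ?_⟩
  ext f
  rw [NormedSpace.dual_def]
  have h1 := (f.continuous.tendsto x).comp hx
  have h2 := (φ.continuous.tendsto f).comp (proj_tendsto hd hJ f)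
  refine tendsto_nhds_unique h1 ?_
  refine h2.congr fun n => ?_
  simp only [Function.comp]
  exact (hb n f).symm

lemma fail1 (hd : DenseRange J) (hJ : ∀ x, ‖J x‖ = NN x) : ¬ Dominates (cf J) (ee J) := by
  rintro ⟨C, hC⟩
  obtain ⟨k, hk⟩ := exists_nat_gt C
  have hD : (k : ℝ) + 1 ≤ Dl k := by exact_mod_cast Dl_ge k
  have hDp : (0 : ℝ) < Dl k := by exact_mod_cast Dl_pos k
  have hdp := dl_pos k
  set n := Dl k ^ 9 with hn
  set t := dl k ^ 5 with ht
  have ht0 : 0 < t := by positivity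
  have hnM : 1 ≤ n * MM t := by
    calc (1 : ℝ) = n * dl k ^ 9 := by
          rw [hn, dl_eq]; push_cast; field_simp
      _ ≤ n * MM t := by gcongr; exact MM_large k
  have h1 := hC (Finset.range n) fun _ => 1
  have h2 := sum_ee (J := J) id (Finset.range n) fun _ => 1
  simp only [id] at h2
  rw [h2, hJ] at h1
  have h3 := NN_one_ge ht0 hnM
  have h4 : ‖∑ i ∈ Finset.range n, (1 : ℝ) • cf J i‖ ≤ n * t := by
    refine opNorm_le hd hJ _ (by positivity) fun x => ?_
    have := sum_le_of_MM ht0 hnM x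
    simpa [ContinuousLinearMap.sum_apply, cf_apply hd hJ] using this
  have hC0 : 0 ≤ |C| := abs_nonneg C
  have h5 : NN (fv id (Finset.range n) fun _ => 1) ≤ |C| * (n * t) :=
    h1.trans (mul_le_mul (le_abs_self C) h4 (norm_nonneg _) hC0)
  have h6 : 1 ≤ t * (|C| * (n * t)) := h3.trans (by gcongr)
  have h7 : t * (|C| * (n * t)) = |C| / Dl k := by
    rw [ht, hn, dl_eq]; push_cast; field_simp
  rw [h7, le_div_iff₀ hDp, one_mul] at h6
  have hCpos : 0 ≤ C := by
    by_contra! hneg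
    have : C * ‖∑ i ∈ Finset.range n, (1 : ℝ) • cf J i‖ ≤ 0 :=
      mul_nonpos_of_nonpos_of_nonneg hneg.le (norm_nonneg _)
    have : t * NN (fv id (Finset.range n) fun _ => 1) ≤ 0 :=
      mul_nonpos_of_nonneg_of_nonpos ht0.le (h1.trans this)
    linarith
  rw [abs_of_nonneg hCpos] at h6
  linarith

lemma fail2 (hd : DenseRange J) (hJ : ∀ x, ‖J x‖ = NN x) :
    ¬ ∃ C : ℝ, ∀ (s : Finset ℕ) (a : ℕ → ℝ),
        ‖∑ i ∈ s, a i • cf J i‖ ≤ C * (∑ i ∈ s, |a i| ^ (8 / 5 : ℝ)) ^ (1 / (8 / 5) : ℝ) := by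
  rintro ⟨C, hC⟩
  obtain ⟨k, hk⟩ := exists_nat_gt C
  have hD : ((k + 1 : ℕ) : ℝ) + 1 ≤ Dl (k + 1) := by exact_mod_cast Dl_ge (k + 1)
  have hDp : (0 : ℝ) < Dl (k + 1) := by exact_mod_cast Dl_pos (k + 1)
  have hdp := dl_pos (k + 1)
  set D : ℝ := ((Dl (k + 1) : ℕ) : ℝ) with hDd
  set n := Dl (k + 1) ^ 56 with hn
  have hnD : (n : ℝ) = D ^ 56 := by rw [hn]; push_cast; rfl
  set t := dl (k + 1) ^ 20 with ht
  have ht0 : 0 < t := by positivity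
  have hnM : n * MM t ≤ 1 := by
    calc n * MM t ≤ n * dl (k + 1) ^ 56 := by gcongr; exact MM_small k
      _ = 1 := by rw [hnD, dl_eq, ← hDd]; field_simp
  have h1 := hC (Finset.range n) fun _ => 1
  have h3 := NN_one_le ht0 hnM
  have e1 : (∑ i ∈ Finset.range n, |(1 : ℝ)| ^ (8 / 5 : ℝ)) ^ (1 / (8 / 5) : ℝ) = D ^ 35 := by
    simp only [abs_one, Real.one_rpow, Finset.sum_const, Finset.card_range, nsmul_eq_mul, mul_one]
    rw [hnD, ← Real.rpow_natCast, ← Real.rpow_mul hDp.le, ← Real.rpow_natCast]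
    norm_num
  rw [e1] at h1
  have h4 := (∑ i ∈ Finset.range n, (1 : ℝ) • cf J i).le_opNorm
    (J (fv id (Finset.range n) fun _ => 1))
  have e2 : (∑ i ∈ Finset.range n, (1 : ℝ) • cf J i) (J (fv id (Finset.range n) fun _ => 1)) = n := by
    rw [ContinuousLinearMap.sum_apply]
    have : ∀ i ∈ Finset.range n, ((1 : ℝ) • cf J i) (J (fv id (Finset.range n) fun _ => 1)) = 1 := by
      intro i hi
      rw [ContinuousLinearMap.smul_apply, cf_apply hd hJ, fv_apply]
      simp only [hi, if_true, smul_eq_mul, mul_one]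
    rw [Finset.sum_congr rfl this]
    simp
  rw [e2, hJ, Real.norm_of_nonneg (by positivity)] at h4
  set w := NN (fv id (Finset.range n) fun _ => 1)
  have hw : 0 ≤ w := apply_nonneg NN _
  have h5 : (n : ℝ) * t ≤ C * D ^ 35 := by
    calc (n : ℝ) * t ≤ (‖∑ i ∈ Finset.range n, (1 : ℝ) • cf J i‖ * w) * t := by gcongr
      _ = ‖∑ i ∈ Finset.range n, (1 : ℝ) • cf J i‖ * (t * w) := by ring
      _ ≤ ‖∑ i ∈ Finset.range n, (1 : ℝ) • cf J i‖ * 1 := by gcongr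
      _ ≤ _ := by rw [mul_one]; exact h1
  have e3 : (n : ℝ) * t = D * D ^ 35 := by
    rw [hnD, ht, dl_eq, ← hDd]; field_simp
  rw [e3] at h5
  have h6 := le_of_mul_le_mul_right h5 (by positivity)
  push_cast at hD
  linarith

lemma upperP (hJ : ∀ x, ‖J x‖ = NN x) : UpperPEstimate (ee J) (8 / 5) := by
  refine ⟨1, fun n x s a hx hdis => ?_⟩
  have hx' : ∀ k, k < n → x k = J (fv id (s k) (a k)) := fun k hk => by
    rw [hx k hk, ← sum_ee]; rfl
  have h := upper_est n (fun k => fv id (s k) (a k)) (fun k l hk hl hkl =>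
    Finset.disjoint_of_subset_left (fv_support _ _)
      (Finset.disjoint_of_subset_right (fv_support _ _) (hdis k l hk hl hkl)))
  have e1 : ∑ k ∈ Finset.range n, x k = J (∑ k ∈ Finset.range n, fv id (s k) (a k)) := by
    rw [map_sum]
    exact Finset.sum_congr rfl fun k hk => hx' k (Finset.mem_range.1 hk)
  have e2 : ∑ k ∈ Finset.range n, ‖x k‖ ^ (8 / 5 : ℝ) =
      ∑ k ∈ Finset.range n, NN (fv id (s k) (a k)) ^ (8 / 5 : ℝ) :=
    Finset.sum_congr rfl fun k hk => by rw [hx' k (Finset.mem_range.1 hk), hJ]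
  rw [e1, e2, hJ, one_mul, show (1 / (8 / 5) : ℝ) = 5 / 8 by norm_num]
  exact h

lemma uncond (hJ : ∀ x, ‖J x‖ = NN x) : IsNormalizedUnconditionalBasic (ee J) := by
  refine ⟨fun i => by rw [ee, hJ, NN_single], 1, fun S F hSF a => ?_⟩
  have h2 := sum_ee (J := J) id S a
  have h3 := sum_ee (J := J) id F a
  simp only [id] at h2 h3
  rw [h2, h3, hJ, hJ, one_mul]
  refine NN_mono_coord fun i => ?_
  rw [fv_apply, fv_apply]
  by_cases h : i ∈ S
  · simp [h, hSF h]
  · simp [h]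

lemma symm_seq (hJ : ∀ x, ‖J x‖ = NN x) : IsSymmetricSeq (ee J) := by
  intro σ
  have key : ∀ (s : Finset ℕ) (a : ℕ → ℝ),
      ‖∑ i ∈ s, a i • ee J (σ i)‖ = ‖∑ i ∈ s, a i • ee J i‖ := by
    intro s a
    have h2 := sum_ee (J := J) id s a
    simp only [id] at h2
    rw [h2, sum_ee, hJ, hJ, NN_fv_perm]
  exact ⟨⟨1, fun s a => by rw [one_mul, key]⟩, ⟨1, fun s a => by rw [one_mul, key]⟩⟩

end space

end OrliczEx


/-- existence of the space `E` of the Example. -/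
theorem statement13 : ∃ p : ℝ, 1 < p ∧ p < 2 ∧
    ∃ (E : Type) (_ : NormedAddCommGroup E) (_ : NormedSpace ℝ E) (_ : CompleteSpace E)
      (e : ℕ → E) (e' : ℕ → E →L[ℝ] ℝ),
      Dense (Submodule.span ℝ (Set.range e) : Set E) ∧
      IsNormalizedUnconditionalBasic e ∧
      IsSymmetricSeq e ∧
      IsReflexiveSpace E ∧
      (∀ i j, e' i (e j) = if i = j then 1 else 0) ∧
      UpperPEstimate e p ∧
      ¬ Dominates e' e ∧
      ¬ ∃ C : ℝ, ∀ (s : Finset ℕ) (a : ℕ → ℝ),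
        ‖∑ i ∈ s, a i • e' i‖ ≤ C * (∑ i ∈ s, |a i| ^ p) ^ (1 / p) := by
  obtain ⟨E, i1, i2, i3, J, hd, hJ⟩ := OrliczEx.exists_compl (ℕ →₀ ℝ) OrliczEx.NN
  refine ⟨8 / 5, by norm_num, by norm_num, E, i1, i2, i3, OrliczEx.ee J, OrliczEx.cf J,
    OrliczEx.dense_span hd, OrliczEx.uncond hJ, OrliczEx.symm_seq hJ, OrliczEx.reflexive hd hJ,
    ?_, OrliczEx.upperP hJ, OrliczEx.fail1 hd hJ, OrliczEx.fail2 hd hJ⟩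
  intro i j
  rw [OrliczEx.ee, OrliczEx.cf_apply hd hJ, Finsupp.single_apply]
  simp only [eq_comm]
end
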